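/- arXiv:2206.12524 — 2 statements merged into one kernel-verified Lean document; each statement's English description precedes it below -/
import Mathlib

section
/- Homogeneous quartic GPSR manifolds are singular at infinity (Proposition 4.1): let n ≥ 1, let h : ℝ^{n+1} → ℝ be a homogeneous quartic polynomial, and let H be a nonempty connected component of the set {p ∈ ℝ^{n+1} : h(p) = 1 and p is a hyperbolic point of h}. Assume H is a homogeneous space under linear automorphisms of h: for all p, q ∈ H there exists A ∈ GL(n+1,ℝ) with h(A·v) = h(v) for all v ∈ ℝ^{n+1} and A·p = q. Then H is singular at infinity: there exists a point p ∈ ℝ^{n+1} with p ≠ 0, p in the topological boundary of the cone ℝ_{>0}·H, h(p) = 0, and the differential of h at p equal to zero. -/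
noncomputable section

/-- The Hessian bilinear form of `f : E → ℝ` at `p`, evaluated on `(u, w)`. -/
def hessBilin {E : Type*} [NormedAddCommGroup E] [NormedSpace ℝ E]
    (f : E → ℝ) (p u w : E) : ℝ :=
  iteratedFDeriv ℝ 2 f p ![u, w]

/-- `p` is a hyperbolic point of `f : E → ℝ` (with `dim E = n + 1`): the Hessian of `f`
at `p` has signature `(1, n)`, i.e. there are a vector `v` and an `n`-dimensional subspace
`W` with `ℝ·v ⊕ W = E`, `Hess_p f (v,v) > 0` and `Hess_p f` negative definite on `W`. -/
def IsHyperbolicPt {E : Type*} [NormedAddCommGroup E] [NormedSpace ℝ E]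
    (n : ℕ) (f : E → ℝ) (p : E) : Prop :=
  ∃ (v : E) (W : Submodule ℝ E), Module.finrank ℝ W = n ∧
    IsCompl (Submodule.span ℝ {v}) W ∧
    0 < hessBilin f p v v ∧
    ∀ w ∈ W, w ≠ 0 → hessBilin f p w w < 0

open Set Filter Topology
open scoped ContDiff

section Calculus

variable {E : Type*} [NormedAddCommGroup E] [NormedSpace ℝ E]

lemma hessBilin_eq_fderiv (f : E → ℝ) (x u v : E) :
    hessBilin f x u v = fderiv ℝ (fderiv ℝ f) x u v := by
  simp [hessBilin, iteratedFDeriv_two_apply]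

lemma differentiable_fderiv_of_contDiff {f : E → ℝ} (hf : ContDiff ℝ ∞ f) :
    Differentiable ℝ (fderiv ℝ f) :=
  (hf.fderiv_right (m := ∞) (by simp)).differentiable (by simp)

lemma continuous_hessBilin {f : E → ℝ} (hf : ContDiff ℝ ∞ f) :
    Continuous fun z : E × E × E => hessBilin f z.1 z.2.1 z.2.2 := by
  simp only [hessBilin_eq_fderiv]
  have h2 : Continuous (fderiv ℝ (fderiv ℝ f)) :=
    (hf.fderiv_right (m := ∞) (by simp)).continuous_fderiv (by simp)
  fun_prop

lemma continuous_fderiv_uncurry {f : E → ℝ} (hf : ContDiff ℝ ∞ f) :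
    Continuous fun z : E × E => fderiv ℝ f z.1 z.2 := by
  have h1 : Continuous (fderiv ℝ f) := hf.continuous_fderiv (by simp)
  fun_prop

lemma hessBilin_comm {f : E → ℝ} (hf : ContDiff ℝ ∞ f) (x u v : E) :
    hessBilin f x u v = hessBilin f x v u := by
  simp only [hessBilin_eq_fderiv]
  exact (hf.contDiffAt.isSymmSndFDerivAt
    (by simpa using (mod_cast le_top : ((2 : ℕ∞) : WithTop ℕ∞) ≤ ∞))) u v

lemma hasDerivAt_line {f : E → ℝ} (hf : ContDiff ℝ ∞ f) (x w : E) (t : ℝ) :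
    HasDerivAt (fun s : ℝ => f (x + s • w)) (fderiv ℝ f (x + t • w) w) t := by
  have hl : HasDerivAt (fun s : ℝ => x + s • w) w t := by
    simpa using ((hasDerivAt_id t).smul_const w).const_add x
  exact ((hf.differentiable (by simp)) _).hasFDerivAt.comp_hasDerivAt t hl

lemma hasDerivAt_fderiv_line {f : E → ℝ} (hf : ContDiff ℝ ∞ f) (x w v : E) (t : ℝ) :
    HasDerivAt (fun s : ℝ => fderiv ℝ f (x + s • w) v) (hessBilin f (x + t • w) w v) t := by
  have hl : HasDerivAt (fun s : ℝ => x + s • w) w t := by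
    simpa using ((hasDerivAt_id t).smul_const w).const_add x
  rw [hessBilin_eq_fderiv]
  exact ((differentiable_fderiv_of_contDiff hf _).hasFDerivAt.comp_hasDerivAt t hl).clm_apply
    (hasDerivAt_const t v) |>.congr_deriv (by simp)

lemma fderiv_map_of_semiinvariant {f : E → ℝ} (hf : ContDiff ℝ ∞ f) {k : ℝ} {L : E →L[ℝ] E}
    (hL : ∀ v, f (L v) = k * f v) (x u : E) :
    fderiv ℝ f (L x) (L u) = k * fderiv ℝ f x u := by
  have h1 := hasDerivAt_line hf (L x) (L u) 0
  have h2 := (hasDerivAt_line hf x u 0).const_mul k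
  have h3 : (fun s : ℝ => f (L x + s • L u)) = fun s : ℝ => k * f (x + s • u) := by
    funext s
    rw [← hL, map_add, map_smul]
  rw [h3] at h1
  simpa using h1.unique h2

lemma hessBilin_map_of_semiinvariant {f : E → ℝ} (hf : ContDiff ℝ ∞ f) {k : ℝ} {L : E →L[ℝ] E}
    (hL : ∀ v, f (L v) = k * f v) (x u v : E) :
    hessBilin f (L x) (L u) (L v) = k * hessBilin f x u v := by
  have h1 := hasDerivAt_fderiv_line hf (L x) (L u) (L v) 0
  have h2 := (hasDerivAt_fderiv_line hf x u v 0).const_mul k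
  have h3 : (fun s : ℝ => fderiv ℝ f (L x + s • L u) (L v)) =
      fun s : ℝ => k * fderiv ℝ f (x + s • u) v := by
    funext s
    rw [← fderiv_map_of_semiinvariant hf hL, map_add, map_smul]
  rw [h3] at h1
  simpa using h1.unique h2

/-- Strict second derivative test along a line. -/
lemma eventually_lt_of_hessBilin_neg {f : E → ℝ} (hf : ContDiff ℝ ∞ f) {x w : E}
    (h1 : fderiv ℝ f x w = 0) (h2 : hessBilin f x w w < 0) :
    ∀ᶠ t in 𝓝 (0 : ℝ), t ≠ 0 → f (x + t • w) < f x := by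
  set c := -hessBilin f x w w / 4 with hc
  have hc0 : 0 < c := by rw [hc]; linarith
  have hd : ∀ t, HasDerivAt (fun s : ℝ => f (x + s • w) + c * s ^ 2)
      (fderiv ℝ f (x + t • w) w + c * (2 * t)) t := fun t =>
    ((hasDerivAt_line hf x w t).add (((hasDerivAt_id t).pow 2).const_mul c)).congr_deriv (by simp)
  have hd' : deriv (fun s : ℝ => f (x + s • w) + c * s ^ 2) =
      fun t => fderiv ℝ f (x + t • w) w + c * (2 * t) := funext fun t => (hd t).deriv
  have hdd : HasDerivAt (fun t : ℝ => fderiv ℝ f (x + t • w) w + c * (2 * t))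
      (hessBilin f x w w + c * 2) 0 :=
    ((hasDerivAt_fderiv_line hf x w w 0).add
      (((hasDerivAt_id (0 : ℝ)).const_mul 2).const_mul c)).congr_deriv (by simp)
  have hmax := isLocalMax_of_deriv_deriv_neg (f := fun s : ℝ => f (x + s • w) + c * s ^ 2)
    (x₀ := 0) (by rw [hd', hdd.deriv, hc]; linarith) (by rw [hd']; simpa using h1)
    (hd 0).continuousAt
  filter_upwards [hmax] with t ht ht0
  have : 0 < c * t ^ 2 := by positivity
  simp only [zero_smul, add_zero, ne_eq, OfNat.ofNat_ne_zero, not_false_eq_true, zero_pow,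
    mul_zero] at ht
  linarith

end Calculus

section Homogeneous

variable {E : Type*} [NormedAddCommGroup E] [NormedSpace ℝ E] {h : E → ℝ}

lemma fderiv_smul_of_homogeneous (hs : ContDiff ℝ ∞ h) (hm : ∀ (c : ℝ) x, h (c • x) = c ^ 4 * h x)
    {c : ℝ} (hc : c ≠ 0) (x v : E) : fderiv ℝ h (c • x) v = c ^ 3 * fderiv ℝ h x v := by
  have := fderiv_map_of_semiinvariant hs (L := c • ContinuousLinearMap.id ℝ E) (k := c ^ 4)
    (fun v => by simpa using hm c v) x v
  simp only [smul_apply, ContinuousLinearMap.id_apply, map_smul,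
    smul_eq_mul] at this
  apply mul_left_cancel₀ hc
  rw [this]; ring

lemma hessBilin_smul_of_homogeneous (hs : ContDiff ℝ ∞ h)
    (hm : ∀ (c : ℝ) x, h (c • x) = c ^ 4 * h x)
    {c : ℝ} (hc : c ≠ 0) (x u v : E) : hessBilin h (c • x) u v = c ^ 2 * hessBilin h x u v := by
  have := hessBilin_map_of_semiinvariant hs (L := c • ContinuousLinearMap.id ℝ E) (k := c ^ 4)
    (fun v => by simpa using hm c v) x u v
  simp only [smul_apply, ContinuousLinearMap.id_apply, map_smul,
    smul_eq_mul, hessBilin_eq_fderiv] at this ⊢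
  apply mul_left_cancel₀ (pow_ne_zero 2 hc)
  rw [← mul_assoc, ← pow_add, ← this]; ring

/-- Euler identity for the differential. -/
lemma fderiv_self_of_homogeneous (hs : ContDiff ℝ ∞ h) (hm : ∀ (c : ℝ) x, h (c • x) = c ^ 4 * h x)
    (x : E) : fderiv ℝ h x x = 4 * h x := by
  have h1 := hasDerivAt_line hs 0 x 1
  have h2 := (((hasDerivAt_id (1 : ℝ)).pow 4).mul_const (h x))
  have h3 : (fun s : ℝ => h (0 + s • x)) = fun s : ℝ => s ^ 4 * h x := by
    funext s
    rw [zero_add, hm]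
  rw [h3] at h1
  simpa using h1.unique h2

/-- Euler identity for the Hessian. -/
lemma hessBilin_self_of_homogeneous (hs : ContDiff ℝ ∞ h)
    (hm : ∀ (c : ℝ) x, h (c • x) = c ^ 4 * h x)
    (x v : E) : hessBilin h x x v = 3 * fderiv ℝ h x v := by
  have h1 := hasDerivAt_fderiv_line hs 0 x v 1
  have h2 := (((hasDerivAt_id (1 : ℝ)).pow 3).mul_const (fderiv ℝ h x v))
  have h3 : (fun s : ℝ => fderiv ℝ h (0 + s • x) v) =ᶠ[𝓝 1]
      fun s : ℝ => s ^ 3 * fderiv ℝ h x v := by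
    filter_upwards [isOpen_ne.mem_nhds (one_ne_zero (α := ℝ))] with s hs0
    rw [zero_add, fderiv_smul_of_homogeneous hs hm hs0]
  have h4 := (h3.hasDerivAt_iff.mp h1).unique h2
  simpa using h4

end Homogeneous

section Hyperbolic

variable {E : Type*} [NormedAddCommGroup E] [NormedSpace ℝ E] {h : E → ℝ} {n : ℕ}

lemma IsHyperbolicPt.map_semiinvariant (hs : ContDiff ℝ ∞ h) {L : E ≃L[ℝ] E}
    (hL : ∀ v, h (L v) = h v) {x : E} (hx : IsHyperbolicPt n h x) : IsHyperbolicPt n h (L x) := by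
  obtain ⟨v, W, hW, hc, hv, hneg⟩ := hx
  have hQ : ∀ u w, hessBilin h (L x) (L u) (L w) = hessBilin h x u w := fun u w => by
    simpa using hessBilin_map_of_semiinvariant hs (k := 1) (L := (L : E →L[ℝ] E))
      (by simpa using hL) x u w
  refine ⟨L v, W.map (L.toLinearEquiv : E →ₗ[ℝ] E), ?_, ?_, by rwa [hQ], ?_⟩
  · rw [LinearEquiv.finrank_map_eq, hW]
  · have := hc.map (Submodule.orderIsoMapComap L.toLinearEquiv)
    simpa [Submodule.map_span] using this
  · rintro _ ⟨w, hw, rfl⟩ hw0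
    have := hQ w w
    simp only [LinearEquiv.coe_coe, ContinuousLinearEquiv.coe_toLinearEquiv] at hw0 ⊢
    rw [this]
    exact hneg w hw (by rintro rfl; simp at hw0)

lemma IsHyperbolicPt.smul_of_homogeneous (hs : ContDiff ℝ ∞ h)
    (hm : ∀ (c : ℝ) x, h (c • x) = c ^ 4 * h x) {c : ℝ} (hc : c ≠ 0) {x : E}
    (hx : IsHyperbolicPt n h x) : IsHyperbolicPt n h (c • x) := by
  obtain ⟨v, W, hW, hcom, hv, hneg⟩ := hx
  have : 0 < c ^ 2 := by positivity
  refine ⟨v, W, hW, hcom, ?_, fun w hw hw0 => ?_⟩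
  · rw [hessBilin_smul_of_homogeneous hs hm hc]; positivity
  · rw [hessBilin_smul_of_homogeneous hs hm hc]
    exact mul_neg_of_pos_of_neg this (hneg w hw hw0)

lemma hessBilin_smul_smul (f : E → ℝ) (x : E) (a : ℝ) (w : E) :
    hessBilin f x (a • w) (a • w) = a ^ 2 * hessBilin f x w w := by
  simp only [hessBilin_eq_fderiv, map_smul, smul_apply, smul_eq_mul]; ring

lemma isOpen_isHyperbolicPt [FiniteDimensional ℝ E] (hs : ContDiff ℝ ∞ h) :
    IsOpen {x | IsHyperbolicPt n h x} := by
  rw [isOpen_iff_mem_nhds]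
  rintro x ⟨v, W, hW, hcom, hv, hneg⟩
  have hQ := continuous_hessBilin hs
  have h1 : ∀ᶠ y in 𝓝 x, 0 < hessBilin h y v v :=
    (show Continuous fun y => hessBilin h y v v from
      hQ.comp (by fun_prop : Continuous fun y : E => (y, v, v))).continuousAt.eventually_const_lt hv
  have hK : IsCompact ((W : Set E) ∩ Metric.sphere 0 1) :=
    (isCompact_sphere 0 1).inter_left W.closed_of_finiteDimensional
  have h2 : ∀ᶠ y in 𝓝 x, ∀ w ∈ (W : Set E) ∩ Metric.sphere 0 1, hessBilin h y w w < 0 := by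
    refine hK.eventually_forall_of_forall_eventually fun w hw => ?_
    have hw0 : w ≠ 0 := by
      rintro rfl
      simp at hw
    exact (show Continuous fun z : E × E => hessBilin h z.1 z.2 z.2 from
      hQ.comp (by fun_prop : Continuous fun z : E × E =>
        (z.1, z.2, z.2))).continuousAt.eventually_lt_const (hneg w hw.1 hw0)
  filter_upwards [h1, h2] with y hy1 hy2
  refine ⟨v, W, hW, hcom, hy1, fun w hw hw0 => ?_⟩
  have hw' : 0 < ‖w‖ := norm_pos_iff.mpr hw0
  have := hy2 (‖w‖⁻¹ • w) ⟨W.smul_mem _ hw, by simp [norm_smul, hw'.ne']⟩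
  rw [hessBilin_smul_smul] at this
  exact neg_of_mul_neg_right this (by positivity)

/-- At a hyperbolic point of a positive level set, the Hessian is negative definite on the
tangent space of the level set. -/
lemma IsHyperbolicPt.hessBilin_neg (hs : ContDiff ℝ ∞ h)
    (hm : ∀ (c : ℝ) x, h (c • x) = c ^ 4 * h x) {x : E} (hx : IsHyperbolicPt n h x)
    (hpos : 0 < h x) {w : E} (hw0 : w ≠ 0) (hw : fderiv ℝ h x w = 0) : hessBilin h x w w < 0 := by
  obtain ⟨v, W, -, hcom, -, hneg⟩ := hx
  have hqq : hessBilin h x x x = 12 * h x := by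
    rw [hessBilin_self_of_homogeneous hs hm, fderiv_self_of_homogeneous hs hm]; ring
  have hqw : hessBilin h x x w = 0 := by
    rw [hessBilin_self_of_homogeneous hs hm, hw, mul_zero]
  have hdec : ∀ z : E, ∃ a : ℝ, z - a • v ∈ W := fun z => by
    have : z ∈ Submodule.span ℝ {v} ⊔ W := by rw [hcom.sup_eq_top]; trivial
    obtain ⟨y, hy, u, hu, rfl⟩ := Submodule.mem_sup.mp this
    obtain ⟨a, rfl⟩ := Submodule.mem_span_singleton.mp hy
    exact ⟨a, by simpa using hu⟩
  obtain ⟨a, ha⟩ := hdec x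
  obtain ⟨b, hb⟩ := hdec w
  by_contra! hcon
  have hmem : b • x - a • w ∈ W := by
    have := W.sub_mem (W.smul_mem b ha) (W.smul_mem a hb)
    convert this using 1
    module
  have hval : hessBilin h x (b • x - a • w) (b • x - a • w) =
      b ^ 2 * (12 * h x) + a ^ 2 * hessBilin h x w w := by
    have hwq := hqw
    rw [hessBilin_comm hs] at hwq
    rw [← hqq]
    simp only [hessBilin_eq_fderiv] at hqw hwq ⊢
    simp only [map_sub, map_smul, sub_apply, smul_apply,
      smul_eq_mul, hqw, hwq]
    ring
  have hzero : b • x - a • w = 0 := by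
    by_contra h0
    have := hneg _ hmem h0
    rw [hval] at this
    have : 0 ≤ b ^ 2 * (12 * h x) + a ^ 2 * hessBilin h x w w := by positivity
    linarith
  have hb0 : b = 0 := by
    rw [hzero] at hval
    have h0 : hessBilin h x 0 0 = 0 := by simp [hessBilin_eq_fderiv]
    rw [h0] at hval
    have h1 : 0 ≤ a ^ 2 * hessBilin h x w w := by positivity
    have h2 : b ^ 2 * (12 * h x) ≤ 0 := by linarith
    have h3 : b ^ 2 ≤ 0 := by
      by_contra! h4
      have : 0 < b ^ 2 * (12 * h x) := by positivity
      linarith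
    exact pow_eq_zero_iff (two_ne_zero) |>.mp (le_antisymm h3 (sq_nonneg b))
  subst hb0
  have ha0 : a = 0 := by
    by_contra ha0
    rw [zero_smul, zero_sub, neg_eq_zero] at hzero
    exact hw0 ((smul_eq_zero.mp hzero).resolve_left ha0)
  subst ha0
  have hxW : x ∈ W := by simpa using ha
  have hx0 : x ≠ 0 := by
    rintro rfl
    have := hm 0 0
    simp at this
    linarith
  have := hneg x hxW hx0
  rw [hqq] at this
  linarith

end Hyperbolic

section Cone

variable {E : Type*} [NormedAddCommGroup E] [NormedSpace ℝ E]

/-- The cone `ℝ_{>0}·H`. -/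
def posCone (H : Set E) : Set E := {x | ∃ l : ℝ, 0 < l ∧ ∃ q ∈ H, x = l • q}

lemma subset_posCone (H : Set E) : H ⊆ posCone H := fun q hq => ⟨1, one_pos, q, hq, by simp⟩

lemma smul_mem_posCone {H : Set E} {c : ℝ} (hc : 0 < c) {x : E} (hx : x ∈ posCone H) :
    c • x ∈ posCone H := by
  obtain ⟨l, hl, q, hq, rfl⟩ := hx
  exact ⟨c * l, mul_pos hc hl, q, hq, by rw [mul_smul]⟩

lemma smul_mem_closure_posCone {H : Set E} {c : ℝ} (hc : 0 < c) {x : E}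
    (hx : x ∈ closure (posCone H)) : c • x ∈ closure (posCone H) :=
  map_mem_closure (continuous_const_smul c) hx fun _ hy => smul_mem_posCone hc hy

lemma map_mem_posCone {H : Set E} {L : E ≃L[ℝ] E} (hL : ∀ q ∈ H, L q ∈ H) {x : E}
    (hx : x ∈ posCone H) : L x ∈ posCone H := by
  obtain ⟨l, hl, q, hq, rfl⟩ := hx
  exact ⟨l, hl, L q, hL q hq, by simp⟩

lemma isPreconnected_posCone {H : Set E} (hH : IsPreconnected H) : IsPreconnected (posCone H) := by
  have : posCone H = (fun z : ℝ × E => z.1 • z.2) '' (Ioi 0 ×ˢ H) := by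
    ext x
    constructor
    · rintro ⟨l, hl, q, hq, rfl⟩
      exact ⟨(l, q), ⟨hl, hq⟩, rfl⟩
    · rintro ⟨⟨l, q⟩, ⟨hl, hq⟩, rfl⟩
      exact ⟨l, hl, q, hq, rfl⟩
  rw [this]
  exact (isPreconnected_Ioi.prod hH).image _ (by fun_prop)

/-- A homogeneous continuous function that is positive on a closed cone minus the origin is
bounded below by a multiple of the corresponding power of the norm. -/
lemma exists_pos_mul_norm_pow_le [FiniteDimensional ℝ E] {K : Set E} (hK : IsClosed K)
    (hcone : ∀ c : ℝ, 0 < c → ∀ x ∈ K, c • x ∈ K) {f : E → ℝ} (hf : Continuous f) {k : ℕ}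
    (hk : k ≠ 0) (hhom : ∀ c : ℝ, ∀ x, f (c • x) = c ^ k * f x)
    (hpos : ∀ x ∈ K, x ≠ 0 → 0 < f x) : ∃ c : ℝ, 0 < c ∧ ∀ x ∈ K, c * ‖x‖ ^ k ≤ f x := by
  have hcomp : IsCompact (K ∩ Metric.sphere 0 1) := (isCompact_sphere 0 1).inter_left hK
  have hex : ∃ c : ℝ, 0 < c ∧ ∀ x ∈ K ∩ Metric.sphere 0 1, c ≤ f x := by
    rcases (K ∩ Metric.sphere (0 : E) 1).eq_empty_or_nonempty with he | hne
    · exact ⟨1, one_pos, by simp [he]⟩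
    · obtain ⟨x, hx, hmin⟩ := hcomp.exists_isMinOn hne hf.continuousOn
      refine ⟨f x, hpos x hx.1 ?_, fun y hy => hmin hy⟩
      rintro rfl
      simp at hx
  obtain ⟨c, hc, hle⟩ := hex
  refine ⟨c, hc, fun x hx => ?_⟩
  rcases eq_or_ne x 0 with rfl | hx0
  · have := hhom 0 0
    simp only [smul_zero, zero_pow hk, zero_mul] at this
    simp [this, zero_pow hk]
  · have hn : 0 < ‖x‖ := norm_pos_iff.mpr hx0
    have h1 := hle (‖x‖⁻¹ • x) ⟨hcone _ (inv_pos.mpr hn) x hx, by simp [norm_smul, hn.ne']⟩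
    rw [hhom, inv_pow, ← div_eq_inv_mul, le_div_iff₀ (by positivity)] at h1
    exact h1

end Cone

section Component

variable {E : Type*} [NormedAddCommGroup E] [NormedSpace ℝ E]

/-- `H` is a nonempty connected component of the hyperbolic level set `{h = 1}` of a smooth
function `h` that is homogeneous of degree four, and linear automorphisms of `h` act transitively
on `H`. -/
structure IsHomogeneousComponent (n : ℕ) (h : E → ℝ) (H : Set E) : Prop where
  contDiff : ContDiff ℝ ∞ h
  map_smul : ∀ (c : ℝ) x, h (c • x) = c ^ 4 * h x
  nonempty : H.Nonempty
  component : ∃ p₀ ∈ {p | h p = 1 ∧ IsHyperbolicPt n h p},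
    H = connectedComponentIn {p | h p = 1 ∧ IsHyperbolicPt n h p} p₀
  transitive : ∀ p ∈ H, ∀ q ∈ H, ∃ A : E ≃L[ℝ] E, (∀ v, h (A v) = h v) ∧ A p = q

namespace IsHomogeneousComponent

variable {n : ℕ} {h : E → ℝ} {H : Set E} (hH : IsHomogeneousComponent n h H)
include hH

lemma eq_one {q : E} (hq : q ∈ H) : h q = 1 := by
  obtain ⟨p, -, rfl⟩ := hH.component
  exact (connectedComponentIn_subset _ _ hq).1

lemma isHyperbolicPt {q : E} (hq : q ∈ H) : IsHyperbolicPt n h q := by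
  obtain ⟨p, -, rfl⟩ := hH.component
  exact (connectedComponentIn_subset _ _ hq).2

lemma isPreconnected : IsPreconnected H := by
  obtain ⟨p, -, rfl⟩ := hH.component
  exact isPreconnected_connectedComponentIn

lemma subset_of_isPreconnected {s : Set E} (hs : IsPreconnected s) {q : E} (hqs : q ∈ s)
    (hq : q ∈ H) (hsub : ∀ x ∈ s, h x = 1 ∧ IsHyperbolicPt n h x) : s ⊆ H := by
  obtain ⟨p, -, rfl⟩ := hH.component
  rw [connectedComponentIn_eq hq]
  exact hs.subset_connectedComponentIn hqs hsub

lemma map_mem {A : E ≃L[ℝ] E} (hA : ∀ v, h (A v) = h v) {p : E} (hp : p ∈ H) (hAp : A p ∈ H)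
    {q : E} (hq : q ∈ H) : A q ∈ H := by
  refine hH.subset_of_isPreconnected (hH.isPreconnected.image A A.continuous.continuousOn)
    (mem_image_of_mem A hp) hAp ?_ (mem_image_of_mem A hq)
  rintro _ ⟨x, hx, rfl⟩
  exact ⟨by rw [hA, hH.eq_one hx], (hH.isHyperbolicPt hx).map_semiinvariant hH.contDiff hA⟩

lemma pos {x : E} (hx : x ∈ posCone H) : 0 < h x := by
  obtain ⟨l, hl, q, hq, rfl⟩ := hx
  rw [hH.map_smul, hH.eq_one hq]
  positivity

lemma isHyperbolicPt_of_mem_posCone {x : E} (hx : x ∈ posCone H) : IsHyperbolicPt n h x := by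
  obtain ⟨l, hl, q, hq, rfl⟩ := hx
  exact (hH.isHyperbolicPt hq).smul_of_homogeneous hH.contDiff hH.map_smul hl.ne'

lemma nonneg {x : E} (hx : x ∈ closure (posCone H)) : 0 ≤ h x :=
  closure_minimal (fun _ hy => (hH.pos hy).le)
    (isClosed_le continuous_const hH.contDiff.continuous) hx

omit [NormedAddCommGroup E] [NormedSpace ℝ E] hH in
lemma rpow_neg_quarter_pow {a : ℝ} (ha : 0 < a) : (a ^ (-(1 / 4) : ℝ)) ^ 4 * a = 1 := by
  rw [← Real.rpow_natCast, ← Real.rpow_mul ha.le]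
  norm_num
  rw [Real.rpow_neg_one, inv_mul_cancel₀ ha.ne']

lemma apply_normalize {x : E} (hx : 0 < h x) : h ((h x ^ (-(1 / 4) : ℝ)) • x) = 1 := by
  rw [hH.map_smul, rpow_neg_quarter_pow hx]

lemma continuousOn_normalize : ContinuousOn (fun x => (h x ^ (-(1 / 4) : ℝ)) • x) {x | 0 < h x} :=
  (hH.contDiff.continuous.continuousOn.rpow_const fun _ hx => Or.inl (ne_of_gt hx)).smul
    continuousOn_id

lemma normalize_mem {x : E} (hx : x ∈ posCone H) : (h x ^ (-(1 / 4) : ℝ)) • x ∈ H := by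
  obtain ⟨l, hl, q, hq, rfl⟩ := hx
  have h1 : h (l • q) = l ^ 4 := by rw [hH.map_smul, hH.eq_one hq, mul_one]
  have h2 : (l ^ 4) ^ (-(1 / 4) : ℝ) * l = 1 := by
    rw [← Real.rpow_natCast, ← Real.rpow_mul hl.le]
    norm_num
    rw [Real.rpow_neg_one, inv_mul_cancel₀ hl.ne']
  rw [h1, smul_smul, h2, one_smul]
  exact hq

omit hH in
lemma mem_posCone_of_normalize_mem {x : E} (hx : 0 < h x) (hN : (h x ^ (-(1 / 4) : ℝ)) • x ∈ H) :
    x ∈ posCone H := by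
  have hc : 0 < h x ^ (-(1 / 4) : ℝ) := Real.rpow_pos_of_pos hx _
  exact ⟨(h x ^ (-(1 / 4) : ℝ))⁻¹, inv_pos.mpr hc, _, hN, by rw [inv_smul_smul₀ hc.ne']⟩

lemma mem_of_mem_posCone {x : E} (hx : x ∈ posCone H) (h1 : h x = 1) : x ∈ H := by
  simpa [h1] using hH.normalize_mem hx

lemma isOpen_posCone [FiniteDimensional ℝ E] : IsOpen (posCone H) := by
  rw [Metric.isOpen_iff]
  intro x hx
  have hU : IsOpen ({y | 0 < h y} ∩ {y | IsHyperbolicPt n h y}) :=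
    (isOpen_lt continuous_const hH.contDiff.continuous).inter
      (isOpen_isHyperbolicPt hH.contDiff)
  obtain ⟨ε, hε, hball⟩ := Metric.isOpen_iff.mp hU x
    ⟨hH.pos hx, hH.isHyperbolicPt_of_mem_posCone hx⟩
  refine ⟨ε, hε, fun y hy => mem_posCone_of_normalize_mem (hball hy).1 ?_⟩
  refine hH.subset_of_isPreconnected
    (((convex_ball x ε).isPreconnected).image _ (hH.continuousOn_normalize.mono
      fun z hz => (hball hz).1)) (mem_image_of_mem _ (Metric.mem_ball_self hε))
    (hH.normalize_mem hx) ?_ (mem_image_of_mem _ hy)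
  rintro _ ⟨z, hz, rfl⟩
  exact ⟨hH.apply_normalize (hball hz).1, (hball hz).2.smul_of_homogeneous hH.contDiff hH.map_smul
    (ne_of_gt (Real.rpow_pos_of_pos (hball hz).1 _))⟩

/-- The invariant form `v ↦ (dh_q v)² - Hess_q h (v, v)` is positive definite along `H`. -/
lemma fderiv_sq_sub_hessBilin_pos {q : E} (hq : q ∈ H) {v : E} (hv : v ≠ 0) :
    0 < fderiv ℝ h q v ^ 2 - hessBilin h q v v := by
  set s := fderiv ℝ h q v / 4 with hs
  have hqq : fderiv ℝ h q q = 4 := by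
    rw [fderiv_self_of_homogeneous hH.contDiff hH.map_smul, hH.eq_one hq, mul_one]
  have hQq : ∀ u, hessBilin h q q u = 3 * fderiv ℝ h q u :=
    hessBilin_self_of_homogeneous hH.contDiff hH.map_smul q
  have hu : fderiv ℝ h q (v - s • q) = 0 := by
    rw [map_sub, _root_.map_smul, hqq, hs, smul_eq_mul]; ring
  have hval : hessBilin h q (v - s • q) (v - s • q) = hessBilin h q v v - 12 * s ^ 2 := by
    have h1 := hQq v
    have h2 := hQq v
    have h3 := hQq q
    rw [hessBilin_comm hH.contDiff] at h2
    rw [hqq] at h3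
    have h4 : fderiv ℝ h q v = 4 * s := by rw [hs]; ring
    rw [h4] at h1 h2
    simp only [hessBilin_eq_fderiv] at h1 h2 h3 ⊢
    simp only [map_sub, _root_.map_smul, sub_apply, smul_apply, smul_eq_mul, h1, h2, h3]
    ring
  have h4 : fderiv ℝ h q v = 4 * s := by rw [hs]; ring
  rw [h4]
  rcases eq_or_ne (v - s • q) 0 with h0 | h0
  · have hs0 : s ≠ 0 := by
      rintro h00
      rw [h00, zero_smul, sub_zero] at h0
      exact hv h0
    have : hessBilin h q (v - s • q) (v - s • q) = 0 := by rw [h0]; simp [hessBilin_eq_fderiv]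
    have : 0 < s ^ 2 := by positivity
    nlinarith
  · have := (hH.isHyperbolicPt hq).hessBilin_neg hH.contDiff hH.map_smul
      (by rw [hH.eq_one hq]; exact one_pos) h0 hu
    nlinarith [sq_nonneg s]

lemma exists_uniform_neighborhood [FiniteDimensional ℝ E] : ∃ δ : ℝ, 0 < δ ∧ ∀ q ∈ H, ∀ v,
    fderiv ℝ h q v ^ 2 - hessBilin h q v v < δ → q + v ∈ posCone H := by
  obtain ⟨p, hp⟩ := hH.nonempty
  obtain ⟨ε, hε, hball⟩ := Metric.isOpen_iff.mp hH.isOpen_posCone p (subset_posCone H hp)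
  have hcont : Continuous fun v => fderiv ℝ h p v ^ 2 - hessBilin h p v v :=
    ((fderiv ℝ h p).continuous.pow 2).sub ((continuous_hessBilin hH.contDiff).comp
      (by fun_prop : Continuous fun v : E => (p, v, v)))
  obtain ⟨c, hc, hle⟩ := exists_pos_mul_norm_pow_le (K := univ) isClosed_univ
    (fun _ _ _ _ => mem_univ _) hcont two_ne_zero
    (fun c x => by rw [hessBilin_smul_smul, _root_.map_smul, smul_eq_mul]; ring)
    (fun x _ hx => hH.fderiv_sq_sub_hessBilin_pos hp hx)
  refine ⟨c * ε ^ 2, by positivity, fun q hq v hv => ?_⟩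
  obtain ⟨A, hA, rfl⟩ := hH.transitive p hp q hq
  obtain ⟨u, rfl⟩ := A.surjective v
  have hA' : ∀ v, h ((A : E →L[ℝ] E) v) = 1 * h v := by simpa using hA
  have h1 := fderiv_map_of_semiinvariant hH.contDiff hA' p u
  have h2 := hessBilin_map_of_semiinvariant hH.contDiff hA' p u u
  simp only [ContinuousLinearEquiv.coe_coe, one_mul] at h1 h2
  rw [h1, h2] at hv
  rw [← map_add]
  refine map_mem_posCone (fun x hx => hH.map_mem hA hp hq hx) (hball ?_)
  have h3 := (hle u (mem_univ _)).trans_lt hv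
  have h4 : ‖u‖ < ε := lt_of_pow_lt_pow_left₀ 2 hε.le (lt_of_mul_lt_mul_left h3 hc.le)
  simpa using h4

lemma mem_of_mem_closure [FiniteDimensional ℝ E] {q : E} (hq : q ∈ closure H) : q ∈ H := by
  obtain ⟨δ, hδ, hnhd⟩ := hH.exists_uniform_neighborhood
  have h1 : h q = 1 :=
    closure_minimal (fun _ hy => hH.eq_one hy)
      (isClosed_eq hH.contDiff.continuous continuous_const) hq
  have hcont : Continuous fun y => fderiv ℝ h y (q - y) ^ 2 - hessBilin h y (q - y) (q - y) :=
    (((continuous_fderiv_uncurry hH.contDiff).comp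
      (by fun_prop : Continuous fun y : E => (y, q - y))).pow 2).sub
      ((continuous_hessBilin hH.contDiff).comp
        (by fun_prop : Continuous fun y : E => (y, q - y, q - y)))
  have hev : ∀ᶠ y in 𝓝 q, fderiv ℝ h y (q - y) ^ 2 - hessBilin h y (q - y) (q - y) < δ :=
    hcont.continuousAt.eventually_lt_const (by simpa [hessBilin_eq_fderiv] using hδ)
  obtain ⟨y, hy, hyH⟩ := (mem_closure_iff_frequently.mp hq |>.and_eventually hev).exists
  have := hnhd y hy _ hyH
  rw [add_sub_cancel] at this
  exact hH.mem_of_mem_posCone this h1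

lemma mem_posCone_of_mem_closure [FiniteDimensional ℝ E] {x : E} (hx : x ∈ closure (posCone H))
    (hpos : 0 < h x) : x ∈ posCone H := by
  refine mem_posCone_of_normalize_mem hpos (hH.mem_of_mem_closure ?_)
  have hc : ContinuousAt (fun x => (h x ^ (-(1 / 4) : ℝ)) • x) x :=
    hH.continuousOn_normalize.continuousAt
      ((isOpen_lt continuous_const hH.contDiff.continuous).mem_nhds hpos)
  exact closure_mono (image_subset_iff.mpr fun y hy => hH.normalize_mem hy)
    (mem_closure_image hc hx)

end IsHomogeneousComponent

end Component

section Convexity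

variable {E : Type*} [NormedAddCommGroup E] [NormedSpace ℝ E]

namespace IsHomogeneousComponent

variable {n : ℕ} {h : E → ℝ} {H : Set E} (hH : IsHomogeneousComponent n h H)
include hH

lemma min_le_of_segment_subset {x y z : E} (hxy : segment ℝ x y ⊆ posCone H)
    (hz : z ∈ segment ℝ x y) : min (h x) (h y) ≤ h z := by
  rw [segment_eq_image'] at hxy hz
  obtain ⟨t, ht, rfl⟩ := hz
  have hcont : Continuous fun t : ℝ => h (x + t • (y - x)) :=
    hH.contDiff.continuous.comp (by fun_prop)
  obtain ⟨t₀, ht₀, hmin⟩ := isCompact_Icc.exists_isMinOn (s := Icc (0 : ℝ) 1) ⟨0, by simp⟩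
    hcont.continuousOn
  suffices min (h x) (h y) ≤ h (x + t₀ • (y - x)) from this.trans (hmin ht)
  rcases eq_or_ne x y with rfl | hne
  · simp
  rcases eq_or_lt_of_le ht₀.1 with rfl | h0
  · simp
  rcases eq_or_lt_of_le ht₀.2 with rfl | h1
  · simp
  exfalso
  have hloc : IsLocalMin (fun t : ℝ => h (x + t • (y - x))) t₀ :=
    hmin.isLocalMin (Icc_mem_nhds h0 h1)
  have hmem := hxy (mem_image_of_mem _ ht₀)
  have hd := hloc.hasDerivAt_eq_zero (hasDerivAt_line hH.contDiff x (y - x) t₀)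
  have hQ := (hH.isHyperbolicPt_of_mem_posCone hmem).hessBilin_neg hH.contDiff hH.map_smul
    (hH.pos hmem) (sub_ne_zero.mpr hne.symm) hd
  have hlt := eventually_lt_of_hessBilin_neg hH.contDiff hd hQ
  have hadd : Tendsto (fun s : ℝ => t₀ + s) (𝓝 0) (𝓝 t₀) := by
    simpa using (continuous_const_add t₀).tendsto 0
  have hev := (hlt.and (hadd.eventually hloc)).filter_mono
    (nhdsWithin_le_nhds (s := {0}ᶜ)) |>.and self_mem_nhdsWithin
  obtain ⟨s, ⟨hs1, hs2⟩, hs0⟩ := hev.exists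
  have := hs1 hs0
  rw [add_assoc, ← add_smul] at this
  linarith

lemma segment_subset_posCone [FiniteDimensional ℝ E] {x y : E} (hx : x ∈ posCone H)
    (hy : y ∈ posCone H) : segment ℝ x y ⊆ posCone H := by
  have hopen : IsOpen {y | segment ℝ x y ⊆ posCone H} := by
    rw [isOpen_iff_mem_nhds]
    intro y hy
    have : ∀ᶠ y' in 𝓝 y, ∀ t ∈ Icc (0 : ℝ) 1, x + t • (y' - x) ∈ posCone H := by
      refine isCompact_Icc.eventually_forall_of_forall_eventually fun t ht => ?_
      have hc : Continuous fun z : E × ℝ => x + z.2 • (z.1 - x) := by fun_prop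
      refine hc.continuousAt.eventually_mem (hH.isOpen_posCone.mem_nhds ?_)
      refine hy ?_
      rw [segment_eq_image']
      exact mem_image_of_mem _ ht
    filter_upwards [this] with y' hy'
    rw [segment_eq_image']
    rintro _ ⟨t, ht, rfl⟩
    exact hy' t ht
  refine (isPreconnected_posCone hH.isPreconnected).subset_of_closure_inter_subset hopen
    ⟨x, hx, by simpa using hx⟩ ?_ hy
  rintro y ⟨hcl, hy⟩ z hz
  rw [segment_eq_image'] at hz
  obtain ⟨t, ht, rfl⟩ := hz
  have hc : Continuous fun y : E => x + t • (y - x) := by fun_prop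
  have hmem : ∀ y' ∈ {y | segment ℝ x y ⊆ posCone H}, x + t • (y' - x) ∈ segment ℝ x y' :=
    fun y' _ => by
      rw [segment_eq_image']
      exact mem_image_of_mem _ ht
  have hcl' : x + t • (y - x) ∈ closure (posCone H) :=
    map_mem_closure (f := fun y => x + t • (y - x)) hc hcl fun y' hy' => hy' (hmem y' hy')
  refine hH.mem_posCone_of_mem_closure hcl' ?_
  have hle : min (h x) (h y) ≤ h (x + t • (y - x)) :=
    closure_minimal (s := {y | segment ℝ x y ⊆ posCone H})
      (fun y' hy' => hH.min_le_of_segment_subset hy' (hmem y' hy'))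
      (isClosed_le (continuous_const.min hH.contDiff.continuous)
        (hH.contDiff.continuous.comp hc)) hcl
  exact (lt_min (hH.pos hx) (hH.pos hy)).trans_le hle

lemma le_add_of_mem_posCone [FiniteDimensional ℝ E] {x y : E} (hx : x ∈ posCone H)
    (hy : y ∈ posCone H) : h x ≤ h (x + y) := by
  obtain ⟨a, ha, p, hp, rfl⟩ := hx
  obtain ⟨b, hb, q, hq, rfl⟩ := hy
  have hab : 0 < a + b := add_pos ha hb
  have hseg : (a / (a + b)) • p + (b / (a + b)) • q ∈ segment ℝ p q :=
    ⟨a / (a + b), b / (a + b), by positivity, by positivity, by field_simp, rfl⟩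
  have h1 := hH.min_le_of_segment_subset
    (hH.segment_subset_posCone (subset_posCone H hp) (subset_posCone H hq)) hseg
  rw [hH.eq_one hp, hH.eq_one hq, min_self] at h1
  have h2 : a • p + b • q = (a + b) • ((a / (a + b)) • p + (b / (a + b)) • q) := by
    rw [smul_add, smul_smul, smul_smul, mul_div_cancel₀ _ hab.ne', mul_div_cancel₀ _ hab.ne']
  rw [h2, hH.map_smul, hH.map_smul, hH.eq_one hp]
  have h3 : a ^ 4 ≤ (a + b) ^ 4 := by gcongr; linarith
  have h4 : 0 < (a + b) ^ 4 := by positivity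
  nlinarith

lemma le_add [FiniteDimensional ℝ E] {x w : E} (hx : x ∈ posCone H)
    (hw : w ∈ closure (posCone H)) : h x ≤ h (x + w) :=
  closure_minimal (fun _ hy => hH.le_add_of_mem_posCone hx hy)
    (isClosed_le continuous_const (hH.contDiff.continuous.comp (continuous_const_add x))) hw

lemma fderiv_pos [FiniteDimensional ℝ E] {q w : E} (hq : q ∈ H)
    (hw : w ∈ closure (posCone H)) (hw0 : w ≠ 0) : 0 < fderiv ℝ h q w := by
  have hmono : ∀ t : ℝ, 0 < t → h q ≤ h (q + t • w) := fun t ht =>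
    hH.le_add (subset_posCone H hq) (smul_mem_closure_posCone ht hw)
  have hd : HasDerivAt (fun t : ℝ => h (q + t • w)) (fderiv ℝ h q w) 0 := by
    simpa using hasDerivAt_line hH.contDiff q w 0
  have hge : 0 ≤ fderiv ℝ h q w := by
    refine ge_of_tendsto (hd.tendsto_slope_zero_right) ?_
    filter_upwards [self_mem_nhdsWithin] with t ht
    have := hmono t ht
    have ht' : 0 < t := ht
    simp only [zero_add, zero_smul, add_zero, smul_eq_mul]
    exact mul_nonneg (inv_pos.mpr ht').le (sub_nonneg.mpr this)
  refine lt_of_le_of_ne hge fun h0 => ?_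
  have hQ := (hH.isHyperbolicPt hq).hessBilin_neg hH.contDiff hH.map_smul
    (by rw [hH.eq_one hq]; exact one_pos) hw0 h0.symm
  have hev := (eventually_lt_of_hessBilin_neg hH.contDiff h0.symm hQ).filter_mono
    (nhdsWithin_le_nhds (s := Ioi 0)) |>.and self_mem_nhdsWithin
  obtain ⟨t, ht1, ht2⟩ := hev.exists
  have ht2' : (0 : ℝ) < t := ht2
  linarith [ht1 ht2'.ne', hmono t ht2']

lemma exists_mul_norm_le_fderiv [FiniteDimensional ℝ E] {q : E} (hq : q ∈ H) :
    ∃ c : ℝ, 0 < c ∧ ∀ x ∈ closure (posCone H), c * ‖x‖ ≤ fderiv ℝ h q x := by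
  simpa using exists_pos_mul_norm_pow_le isClosed_closure
    (fun c hc x hx => smul_mem_closure_posCone (H := H) hc hx) (fderiv ℝ h q).continuous
    one_ne_zero (fun c x => by simp) (fun x hx hx0 => hH.fderiv_pos hq hx hx0)

/-- The operator norm of an automorphism of the cone is controlled by its value at one point. -/
lemma exists_norm_map_le [FiniteDimensional ℝ E] {p : E} (hp : p ∈ H) :
    ∃ M : ℝ, 0 < M ∧ ∀ A : E ≃L[ℝ] E, (∀ v, h (A v) = h v) → A p ∈ H →
      ∀ v, ‖A v‖ ≤ M * ‖A p‖ * ‖v‖ := by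
  obtain ⟨c, hc, hle⟩ := hH.exists_mul_norm_le_fderiv hp
  obtain ⟨ε, hε, hball⟩ := Metric.isOpen_iff.mp hH.isOpen_posCone p (subset_posCone H hp)
  refine ⟨2 * (‖fderiv ℝ h p‖ + 1) / (c * ε), by positivity, fun A hA hAp v => ?_⟩
  rcases eq_or_ne v 0 with rfl | hv0
  · simp
  have hn : 0 < ‖v‖ := norm_pos_iff.mpr hv0
  set r : ℝ := ε / 2 / ‖v‖ with hr
  have hr0 : 0 < r := by positivity
  have hrv : ‖r • v‖ < ε := by
    rw [norm_smul, Real.norm_of_nonneg hr0.le, hr, div_mul_cancel₀ _ hn.ne']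
    linarith
  have hmem : ∀ w : E, ‖w‖ < ε → A (p + w) ∈ closure (posCone H) := fun w hw =>
    subset_closure (map_mem_posCone (fun q hq => hH.map_mem hA hp hAp hq)
      (hball (by simpa using hw)))
  have h1 := hle _ (hmem (r • v) hrv)
  have h2 := hle _ (hmem (-(r • v)) (by rwa [norm_neg]))
  rw [map_add, map_add] at h1 h2
  rw [map_neg, map_neg] at h2
  have h3 : ‖A (r • v) + A (r • v)‖ ≤ ‖A p + A (r • v)‖ + ‖A p + -A (r • v)‖ := by
    have := norm_sub_le (A p + A (r • v)) (A p + -A (r • v))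
    rwa [show A p + A (r • v) - (A p + -A (r • v)) = A (r • v) + A (r • v) by abel] at this
  have h4 : ‖A (r • v) + A (r • v)‖ = 2 * (r * ‖A v‖) := by
    rw [← two_smul ℝ, norm_smul, _root_.map_smul, norm_smul, Real.norm_of_nonneg hr0.le]
    norm_num
  have h5 : fderiv ℝ h p (A p) ≤ (‖fderiv ℝ h p‖ + 1) * ‖A p‖ := by
    have := (le_abs_self _).trans ((fderiv ℝ h p).le_opNorm (A p))
    nlinarith [norm_nonneg (A p)]
  rw [h4] at h3
  have h6 : c * (2 * (r * ‖A v‖)) ≤ 2 * ((‖fderiv ℝ h p‖ + 1) * ‖A p‖) := by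
    have := mul_le_mul_of_nonneg_left h3 hc.le
    linarith
  have h7 : c * (2 * (r * ‖A v‖)) = c * ε * ‖A v‖ / ‖v‖ := by
    rw [hr]; field_simp
  rw [h7, div_le_iff₀ hn] at h6
  rw [div_mul_eq_mul_div, div_mul_eq_mul_div, le_div_iff₀ (by positivity)]
  linarith

end IsHomogeneousComponent

end Convexity

section Boundary

variable {E : Type*} [NormedAddCommGroup E] [NormedSpace ℝ E]

namespace IsHomogeneousComponent

variable {n : ℕ} {h : E → ℝ} {H : Set E} (hH : IsHomogeneousComponent n h H)
include hH

lemma exists_ne_zero_apply_eq_zero [FiniteDimensional ℝ E] (hdim : 1 < Module.finrank ℝ E) :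
    ∃ y ∈ closure (posCone H), y ≠ 0 ∧ h y = 0 := by
  obtain ⟨p, hp⟩ := hH.nonempty
  obtain ⟨c, hc, hle⟩ := hH.exists_mul_norm_le_fderiv hp
  obtain ⟨u, hu, hu0⟩ := (Submodule.ne_bot_iff _).mp
    (LinearMap.ker_ne_bot_of_finrank_lt (f := (fderiv ℝ h p : E →ₗ[ℝ] ℝ)) (by simpa using hdim))
  have hu' : fderiv ℝ h p u = 0 := hu
  have hpp : fderiv ℝ h p p = 4 := by
    rw [fderiv_self_of_homogeneous hH.contDiff hH.map_smul, hH.eq_one hp, mul_one]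
  have hline : ∀ t : ℝ, fderiv ℝ h p (p + t • u) = 4 := fun t => by
    rw [map_add, _root_.map_smul, hu', hpp, smul_zero, add_zero]
  by_contra! hcon
  have hcont : Continuous fun t : ℝ => p + t • u := by fun_prop
  have hclopen : IsClopen {t : ℝ | p + t • u ∈ posCone H} := by
    refine ⟨isClosed_of_closure_subset fun t ht => ?_, hH.isOpen_posCone.preimage hcont⟩
    have hcl : p + t • u ∈ closure (posCone H) :=
      map_mem_closure (f := fun t : ℝ => p + t • u) hcont ht fun _ ht => ht
    refine hH.mem_posCone_of_mem_closure hcl (lt_of_le_of_ne (hH.nonneg hcl) (hcon _ hcl ?_).symm)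
    intro h0
    have := hline t
    simp [h0] at this
  have huniv := hclopen.eq_univ ⟨0, by simpa using subset_posCone H hp⟩
  have hall : ∀ t : ℝ, p + t • u ∈ posCone H := fun t =>
    (huniv ▸ mem_univ t : t ∈ {t : ℝ | p + t • u ∈ posCone H})
  have hbound : ∀ t : ℝ, 0 < t → c * (t * ‖u‖ - ‖p‖) ≤ 4 := fun t ht => by
    have h1 := hle _ (subset_closure (hall t))
    rw [hline] at h1
    have h2 : t * ‖u‖ - ‖p‖ ≤ ‖p + t • u‖ := by
      have := norm_sub_norm_le (t • u) (-p)
      rw [norm_neg, sub_neg_eq_add, norm_smul, Real.norm_of_nonneg ht.le, add_comm (t • u)] at this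
      exact this
    exact (mul_le_mul_of_nonneg_left h2 hc.le).trans h1
  have hun : 0 < ‖u‖ := norm_pos_iff.mpr hu0
  have h3 := hbound ((‖p‖ + 5 / c) / ‖u‖) (by positivity)
  rw [div_mul_cancel₀ _ hun.ne', add_sub_cancel_left, mul_div_cancel₀ _ hc.ne'] at h3
  norm_num at h3

/-- If `A p = q` with `p, q ∈ H`, the differential at `q` is controlled by the inverse of `A`. -/
lemma exists_norm_fderiv_le [FiniteDimensional ℝ E] {p : E} (hp : p ∈ H) :
    ∃ M : ℝ, 0 < M ∧ ∀ A : E ≃L[ℝ] E, (∀ v, h (A v) = h v) → A p ∈ H →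
      ‖fderiv ℝ h (A p)‖ ≤ M * ‖A.symm p‖ ∧ ‖fderiv ℝ h (A.symm p)‖ ≤ M * ‖A p‖ := by
  obtain ⟨M, hM, hle⟩ := hH.exists_norm_map_le hp
  have key : ∀ A : E ≃L[ℝ] E, (∀ v, h (A v) = h v) → A.symm p ∈ H →
      ‖fderiv ℝ h (A p)‖ ≤ (‖fderiv ℝ h p‖ + 1) * M * ‖A.symm p‖ := fun A hA hAp => by
    refine ContinuousLinearMap.opNorm_le_bound _ (by positivity) fun v => ?_
    have hA' : ∀ v, h (A.symm v) = h v := fun v => by rw [← hA, A.apply_symm_apply]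
    have h1 := fderiv_map_of_semiinvariant hH.contDiff (k := 1) (L := (A : E →L[ℝ] E))
      (by simpa using hA) p (A.symm v)
    simp only [ContinuousLinearEquiv.coe_coe, A.apply_symm_apply, one_mul] at h1
    rw [h1]
    calc ‖fderiv ℝ h p (A.symm v)‖ ≤ ‖fderiv ℝ h p‖ * ‖A.symm v‖ := (fderiv ℝ h p).le_opNorm _
      _ ≤ (‖fderiv ℝ h p‖ + 1) * (M * ‖A.symm p‖ * ‖v‖) := by
        gcongr
        · linarith
        · exact hle A.symm hA' hAp v
      _ = _ := by ring
  refine ⟨(‖fderiv ℝ h p‖ + 1) * M, by positivity, fun A hA hAp => ?_⟩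
  have hA' : ∀ v, h (A.symm v) = h v := fun v => by rw [← hA, A.apply_symm_apply]
  have hAp' : A.symm p ∈ H := by
    refine hH.map_mem hA' (p := A p) hAp ?_ hp
    rwa [A.symm_apply_apply]
  exact ⟨key A hA hAp', by simpa using key A.symm hA' (by simpa using hAp)⟩

/-- Either a boundary zero of `h` is singular, or the limit point of the inverse automorphisms
is. -/
theorem exists_singular_of_closure [FiniteDimensional ℝ E] (hdim : 1 < Module.finrank ℝ E) :
    ∃ y : E, y ≠ 0 ∧ y ∈ closure (posCone H) ∧ h y = 0 ∧ fderiv ℝ h y = 0 := by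
  obtain ⟨y, hycl, hy0, hy⟩ := hH.exists_ne_zero_apply_eq_zero hdim
  by_cases hdy : fderiv ℝ h y = 0
  · exact ⟨y, hy0, hycl, hy, hdy⟩
  obtain ⟨p, hp⟩ := hH.nonempty
  obtain ⟨M, hM, hbd⟩ := hH.exists_norm_fderiv_le hp
  obtain ⟨x, hx, hlim⟩ := mem_closure_iff_seq_limit.mp hycl
  choose l hl q hq hxq using hx
  choose A hA hAq using fun k => hH.transitive p hp (q k) (hq k)
  have hd : Continuous (fderiv ℝ h) := hH.contDiff.continuous_fderiv (by simp)
  have hl4 : ∀ k, h (x k) = l k ^ 4 := fun k => by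
    rw [hxq, hH.map_smul, hH.eq_one (hq k), mul_one]
  have hl0 : Tendsto (fun k => l k ^ 4) atTop (𝓝 0) := by
    have := (hH.contDiff.continuous.tendsto y).comp hlim
    rw [hy] at this
    exact this.congr fun k => hl4 k
  have hl0' : Tendsto l atTop (𝓝 0) := by
    rw [Metric.tendsto_atTop] at hl0 ⊢
    intro ε hε
    obtain ⟨N, hN⟩ := hl0 (ε ^ 4) (by positivity)
    refine ⟨N, fun k hk => ?_⟩
    have := hN k hk
    rw [Real.dist_eq, sub_zero, abs_of_pos (by have := hl k; positivity)] at this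
    rw [Real.dist_eq, sub_zero, abs_of_pos (hl k)]
    exact lt_of_pow_lt_pow_left₀ 4 hε.le this
  set ν : ℕ → ℝ := fun k => ‖(A k).symm p‖ with hν
  have hdx : ∀ k, ‖fderiv ℝ h (x k)‖ = l k ^ 3 * ‖fderiv ℝ h (q k)‖ := fun k => by
    have : fderiv ℝ h (x k) = l k ^ 3 • fderiv ℝ h (q k) := by
      ext v
      rw [hxq, fderiv_smul_of_homogeneous hH.contDiff hH.map_smul (hl k).ne']
      simp
    rw [this, norm_smul, Real.norm_of_nonneg (by have := hl k; positivity)]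
  set c : ℝ := ‖fderiv ℝ h y‖ / 2 / M with hc
  have hc0 : 0 < c := by
    have := norm_pos_iff.mpr hdy
    positivity
  have hlow : ∀ᶠ k in atTop, c ≤ l k ^ 3 * ν k := by
    have hn := ((hd.tendsto y).comp hlim).norm
    have := hn.eventually_const_lt (half_lt_self (norm_pos_iff.mpr hdy))
    filter_upwards [this] with k hk
    simp only [Function.comp_apply] at hk
    rw [hdx] at hk
    have h1 := (hbd (A k) (hA k) (by rw [hAq]; exact hq k)).1
    rw [hAq] at h1
    rw [hc, div_le_iff₀ hM]
    have h2 := mul_le_mul_of_nonneg_left h1 (by have := hl k; positivity : 0 ≤ l k ^ 3)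
    simp only [hν]
    linarith
  have hl1 : ∀ᶠ k in atTop, l k < 1 := hl0'.eventually_lt_const one_pos
  have hlν : ∀ᶠ k in atTop, c ≤ l k * ν k ∧ 0 < ν k := by
    filter_upwards [hlow, hl1] with k h1 h2
    have hlk := hl k
    have h3 : 0 < ν k := by
      by_contra! h4
      have : l k ^ 3 * ν k ≤ 0 := mul_nonpos_of_nonneg_of_nonpos (by positivity) h4
      linarith
    refine ⟨h1.trans (mul_le_mul_of_nonneg_right ?_ h3.le), h3⟩
    exact pow_le_of_le_one hlk.le h2.le (by norm_num)
  have hνinv : Tendsto (fun k => (ν k)⁻¹) atTop (𝓝 0) := by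
    refine squeeze_zero' (g := fun k => l k / c) ?_ ?_ (by simpa using hl0'.div_const c)
    · filter_upwards [hlν] with k hk using (inv_pos.mpr hk.2).le
    · filter_upwards [hlν] with k hk
      rw [inv_le_iff_one_le_mul₀ hk.2, div_mul_eq_mul_div, le_div_iff₀ hc0]
      linarith [hk.1]
  set z : ℕ → E := fun k => (ν k)⁻¹ • (A k).symm p with hz
  have hA' : ∀ k v, h ((A k).symm v) = h v := fun k v => by rw [← hA k, (A k).apply_symm_apply]
  have hAp' : ∀ k, (A k).symm p ∈ H := fun k => by
    refine hH.map_mem (hA' k) (p := q k) (hq k) ?_ hp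
    rw [← hAq k, (A k).symm_apply_apply]
    exact hp
  have hzsphere : ∀ᶠ k in atTop, z k ∈ Metric.sphere (0 : E) 1 := by
    filter_upwards [hlν] with k hk
    rw [mem_sphere_zero_iff_norm, hz, norm_smul, norm_inv, norm_norm, inv_mul_cancel₀ hk.2.ne']
  obtain ⟨w, hw, φ, hφ, hφlim⟩ := (isCompact_sphere (0 : E) 1).tendsto_subseq' hzsphere.frequently
  have hνφ := hνinv.comp hφ.tendsto_atTop
  have hwlim : Tendsto (fun k => ‖x (φ k)‖ * (ν (φ k))⁻¹ ^ 2 * (M / c)) atTop (𝓝 0) := by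
    have := ((hlim.norm.comp hφ.tendsto_atTop).mul (hνφ.pow 2)).mul_const (M / c)
    simpa using this
  refine ⟨w, ?_, ?_, ?_, ?_⟩
  · rintro rfl
    simp at hw
  · refine mem_closure_of_tendsto hφlim ?_
    filter_upwards [hφ.tendsto_atTop.eventually hlν] with k hk
    exact smul_mem_posCone (inv_pos.mpr hk.2) (subset_posCone H (hAp' _))
  · refine tendsto_nhds_unique ((hH.contDiff.continuous.tendsto w).comp hφlim) ?_
    have := hνφ.pow 4
    rw [zero_pow (by norm_num)] at this
    refine this.congr fun k => ?_
    simp [hz, hH.map_smul, hH.eq_one (hAp' _)]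
  · rw [← norm_eq_zero]
    refine le_antisymm (le_of_tendsto_of_tendsto ((hd.tendsto w).comp hφlim).norm hwlim ?_)
      (norm_nonneg _)
    filter_upwards [hφ.tendsto_atTop.eventually hlν] with k hk
    obtain ⟨hk1, hk2⟩ := hk
    have hlk := hl (φ k)
    have h1 := (hbd (A (φ k)) (hA _) (by rw [hAq]; exact hq _)).2
    rw [hAq] at h1
    have h2 : fderiv ℝ h (z (φ k)) = (ν (φ k))⁻¹ ^ 3 • fderiv ℝ h ((A (φ k)).symm p) := by
      ext v
      rw [hz, fderiv_smul_of_homogeneous hH.contDiff hH.map_smul (inv_pos.mpr hk2).ne']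
      simp
    have h3 : ‖x (φ k)‖ = l (φ k) * ‖q (φ k)‖ := by
      rw [hxq, norm_smul, Real.norm_of_nonneg hlk.le]
    have h4 : 1 ≤ l (φ k) * ν (φ k) / c := by rwa [one_le_div₀ hc0]
    simp only [Function.comp_apply]
    rw [h2, norm_smul, Real.norm_of_nonneg (by positivity), h3]
    calc (ν (φ k))⁻¹ ^ 3 * ‖fderiv ℝ h ((A (φ k)).symm p)‖
        ≤ (ν (φ k))⁻¹ ^ 3 * (M * ‖q (φ k)‖) := by gcongr
      _ ≤ (ν (φ k))⁻¹ ^ 3 * (M * ‖q (φ k)‖) * (l (φ k) * ν (φ k) / c) :=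
        le_mul_of_one_le_right (by positivity) h4
      _ = _ := by field_simp

end IsHomogeneousComponent

end Boundary

section Polynomial

variable {σ : Type*} [Fintype σ]

lemma contDiff_mvPolynomial_eval (P : MvPolynomial σ ℝ) :
    ContDiff ℝ ∞ fun v : σ → ℝ => MvPolynomial.eval v P := by
  induction P using MvPolynomial.induction_on with
  | C a => simpa using contDiff_const
  | add p q hp hq => simpa using hp.add hq
  | mul_X p i hp => simpa using hp.mul (contDiff_apply ℝ ℝ i)

lemma MvPolynomial.IsHomogeneous.eval_smul {P : MvPolynomial σ ℝ} {d : ℕ} (hP : P.IsHomogeneous d)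
    (c : ℝ) (x : σ → ℝ) : MvPolynomial.eval (c • x) P = c ^ d * MvPolynomial.eval x P := by
  rw [MvPolynomial.eval_eq', MvPolynomial.eval_eq', Finset.mul_sum]
  refine Finset.sum_congr rfl fun m hm => ?_
  have hd := hP (MvPolynomial.mem_support_iff.mp hm)
  have : ∏ i, c ^ m i = c ^ d := by
    rw [Finset.prod_pow_eq_pow_sum, ← hd, Finsupp.weight_apply, Finsupp.sum_fintype _ _ (by simp)]
    simp
  simp only [Pi.smul_apply, smul_eq_mul, mul_pow, Finset.prod_mul_distrib, this]
  ring

end Polynomial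

/-- **Homogeneous quartic GPSR manifolds are singular at infinity (Proposition 4.1).**
If a nonempty connected component `H` of the hyperbolic points of the level set `{h = 1}`
of a homogeneous quartic polynomial `h : ℝ^{n+1} → ℝ` is a homogeneous space under linear
automorphisms of `h`, then there is a nonzero point `p` in the topological boundary of the
cone `ℝ_{>0}·H` with `h(p) = 0` and vanishing differential of `h` at `p`. -/
theorem homogeneous_quartic_singular_at_infinity (n : ℕ) (hn : 1 ≤ n)
    (h : (Fin (n + 1) → ℝ) → ℝ)
    (hpoly : ∃ P : MvPolynomial (Fin (n + 1)) ℝ, P.IsHomogeneous 4 ∧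
      h = fun v => MvPolynomial.eval v P)
    (H : Set (Fin (n + 1) → ℝ)) (hne : H.Nonempty)
    (hH : ∃ p₀ ∈ {p | h p = 1 ∧ IsHyperbolicPt n h p},
      H = connectedComponentIn {p | h p = 1 ∧ IsHyperbolicPt n h p} p₀)
    (hhom : ∀ p ∈ H, ∀ q ∈ H, ∃ A : Matrix (Fin (n + 1)) (Fin (n + 1)) ℝ,
      IsUnit A ∧ (∀ v, h (A.mulVec v) = h v) ∧ A.mulVec p = q) :
    ∃ p : Fin (n + 1) → ℝ, p ≠ 0 ∧
      p ∈ frontier {x : Fin (n + 1) → ℝ | ∃ l : ℝ, 0 < l ∧ ∃ q ∈ H, x = l • q} ∧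
      h p = 0 ∧ fderiv ℝ h p = 0 := by
  obtain ⟨P, hP, hPh⟩ := hpoly
  have hH' : IsHomogeneousComponent n h H := by
    refine ⟨?_, fun c x => ?_, hne, hH, fun p hp q hq => ?_⟩
    · rw [hPh]
      exact contDiff_mvPolynomial_eval P
    · simp only [hPh]
      exact hP.eval_smul c x
    · obtain ⟨A, hA, hAh, hAp⟩ := hhom p hp q hq
      refine ⟨(Matrix.toLinearEquiv' A hA.invertible).toContinuousLinearEquiv, fun v => ?_, ?_⟩
      · exact hAh v
      · exact hAp
  obtain ⟨p, hp0, hpcl, hp, hdp⟩ :=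
    hH'.exists_singular_of_closure (by simpa using Nat.lt_of_lt_of_le one_pos hn)
  refine ⟨p, hp0, ⟨hpcl, fun hint => ?_⟩, hp, hdp⟩
  exact (hH'.pos (interior_subset hint)).ne' hp
end
end

section
/- Critical values for homogeneous quartics in standard form (Corollary 4.2): let n ≥ 1, let P₃ : ℝⁿ → ℝ and P₄ : ℝⁿ → ℝ be homogeneous polynomials of degrees 3 and 4 respectively, and define h : ℝ × ℝⁿ → ℝ by h(x,y) = x⁴ − x²·⟨y,y⟩ + x·P₃(y) + P₄(y). Let H be the connected component containing (1,0) of the set {p ∈ ℝ^{n+1} : h(p) = 1 and p is a hyperbolic point of h}, and assume H is a homogeneous space under linear automorphisms of h: for all p, q ∈ H there exists A ∈ GL(n+1,ℝ) with h(A·v) = h(v) for all v and A·p = q. Then every critical point ȳ of the restriction of y ↦ h(1,y) to the unit sphere S^{n−1} = {y ∈ ℝⁿ : ⟨y,y⟩ = 1} (i.e. every ȳ ∈ S^{n−1} such that the differential of y ↦ h(1,y) at ȳ vanishes on the orthogonal complement of ȳ) satisfies either (P₃(ȳ) = 0 and P₄(ȳ) = 1/4) or (|P₃(ȳ)| = 2√2/(3√3)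 and P₄(ȳ) = −1/12). -/
noncomputable section

open Filter Topology in
/-- A tangent vector to the group of linear automorphisms of `h`, obtained as a limit of rescaled
differences `A - 1`, is an infinitesimal automorphism of `h`. -/
theorem fderiv_apply_eq_zero_of_tendsto {E : Type*} [NormedAddCommGroup E] [NormedSpace ℝ E]
    {h : E → ℝ} (hd : Differentiable ℝ h) {Y : ℕ → E →L[ℝ] E} {c : ℕ → ℝ} {L : E →L[ℝ] E}
    (hY : Tendsto Y atTop (𝓝 0)) (hcY : Tendsto (fun k => c k • Y k) atTop (𝓝 L))
    (hinv : ∀ᶠ k in atTop, ∀ p, h (p + Y k p) = h p) (p : E) :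
    fderiv ℝ h p (L p) = 0 := by
  have happ (Z : ℕ → E →L[ℝ] E) (M : E →L[ℝ] E) (hZ : Tendsto Z atTop (𝓝 M)) :
      Tendsto (fun k => Z k p) atTop (𝓝 (M p)) :=
    ((ContinuousLinearMap.apply ℝ E p).continuous.tendsto M).comp hZ
  have hlim := (hasFDerivWithinAt_univ.2 (hd p).hasFDerivAt).lim (happ Y 0 hY)
    (Eventually.of_forall fun _ => Set.mem_univ _) (happ _ L hcY)
  refine tendsto_nhds_unique hlim (tendsto_const_nhds.congr' ?_)
  filter_upwards [hinv] with k hk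
  simp [hk p]

/-- The exponential of an infinitesimal automorphism of `h` is an automorphism of `h`. -/
theorem apply_exp_eq_of_fderiv_apply_eq_zero {E : Type*} [NormedAddCommGroup E] [NormedSpace ℝ E]
    [CompleteSpace E] {h : E → ℝ} (hd : Differentiable ℝ h) {X : E →L[ℝ] E}
    (hX : ∀ p, fderiv ℝ h p (X p) = 0) (p : E) : h (NormedSpace.exp X p) = h p := by
  have hder (s : ℝ) : HasDerivAt (fun s : ℝ => h (NormedSpace.exp (s • X) p)) 0 s := by
    have h1 : HasDerivAt (fun s : ℝ => NormedSpace.exp (s • X) p)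
        (X (NormedSpace.exp (s • X) p)) s :=
      (ContinuousLinearMap.apply ℝ E p).hasFDerivAt.comp_hasDerivAt s
        (hasDerivAt_exp_smul_const' X s)
    have h2 := (hd _).hasFDerivAt.comp_hasDerivAt s h1
    rwa [hX] at h2
  have := is_const_of_deriv_eq_zero (fun s => (hder s).differentiableAt)
    (fun s => (hder s).deriv) 1 0
  simpa using this

/-- The exponential of an endomorphism fixes the kernel of that endomorphism pointwise. -/
theorem exp_apply_eq_of_apply_eq_zero {E : Type*} [NormedAddCommGroup E] [NormedSpace ℝ E]
    [CompleteSpace E] {X : E →L[ℝ] E} {p : E} (hX : X p = 0) : NormedSpace.exp X p = p := by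
  have hder (s : ℝ) : HasDerivAt (fun s : ℝ => NormedSpace.exp (s • X) p) 0 s := by
    have h1 : HasDerivAt (fun s : ℝ => NormedSpace.exp (s • X) p)
        (NormedSpace.exp (s • X) (X p)) s :=
      (ContinuousLinearMap.apply ℝ E p).hasFDerivAt.comp_hasDerivAt s
        (hasDerivAt_exp_smul_const X s)
    rwa [hX, map_zero] at h1
  have := is_const_of_deriv_eq_zero (fun s => (hder s).differentiableAt)
    (fun s => (hder s).deriv) 1 0
  simpa using this

/-- Near the identity every element of a finite-dimensional algebra factors as `(1 + y) * exp x`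
with small `y` and `x` in prescribed complementary subspaces. -/
theorem exists_factor_one_add_mul_exp {𝔸 : Type*} [NormedRing 𝔸] [NormedAlgebra ℝ 𝔸]
    [FiniteDimensional ℝ 𝔸] {C K : Submodule ℝ 𝔸} (hCK : IsCompl C K) :
    ∃ g : 𝔸 → C × K, Filter.Tendsto g (nhds 1) (nhds 0) ∧
      ∀ᶠ a in nhds (1 : 𝔸), (1 + ((g a).1 : 𝔸)) * NormedSpace.exp ((g a).2 : 𝔸) = a := by
  have : CompleteSpace 𝔸 := FiniteDimensional.complete ℝ 𝔸
  let f : C × K → 𝔸 := fun z => (1 + (z.1 : 𝔸)) * NormedSpace.exp (z.2 : 𝔸)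
  let f' : (C × K) ≃L[ℝ] 𝔸 := (Submodule.prodEquivOfIsCompl C K hCK).toContinuousLinearEquiv
  have hf : HasStrictFDerivAt f (f' : (C × K) →L[ℝ] 𝔸) 0 := by
    have h1 : HasStrictFDerivAt (fun z : C × K => 1 + (z.1 : 𝔸))
        (C.subtypeL ∘L ContinuousLinearMap.fst ℝ C K) 0 :=
      (C.subtypeL ∘L ContinuousLinearMap.fst ℝ C K).hasStrictFDerivAt.const_add (1 : 𝔸)
    have h2 : HasStrictFDerivAt (fun z : C × K => NormedSpace.exp (z.2 : 𝔸))
        ((1 : 𝔸 →L[ℝ] 𝔸) ∘L (K.subtypeL ∘L ContinuousLinearMap.snd ℝ C K)) 0 :=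
      HasStrictFDerivAt.comp (g := NormedSpace.exp) (0 : C × K)
        (by simpa using hasStrictFDerivAt_exp_zero (𝕂 := ℝ) (𝔸 := 𝔸))
        (K.subtypeL ∘L ContinuousLinearMap.snd ℝ C K).hasStrictFDerivAt
    refine (h1.mul' h2).congr_fderiv ?_
    ext z <;> simp [f']
  have hf0 : f 0 = 1 := by simp [f]
  refine ⟨hf.localInverse f f' 0, ?_, ?_⟩
  · simpa [hf0] using hf.localInverse_tendsto
  · have := hf.eventually_right_inverse
    rwa [hf0] at this

open Filter Topology in
/-- If automorphisms of `h` tending to the identity move `e` along a differentiable curve, then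
the velocity of the curve at `e` is the value at `e` of an infinitesimal automorphism of `h`. -/
theorem exists_infinitesimal_automorphism {E : Type*} [NormedAddCommGroup E] [NormedSpace ℝ E]
    [FiniteDimensional ℝ E] {h : E → ℝ} (hd : Differentiable ℝ h) {e v : E} {q : ℝ → E}
    (hq : HasDerivAt q v 0) (hq0 : q 0 = e) {A : ℕ → E →L[ℝ] E} {t : ℕ → ℝ}
    (hA : Tendsto A atTop (𝓝 1)) (hAh : ∀ k p, h (A k p) = h p)
    (ht : Tendsto t atTop (𝓝 0)) (ht0 : ∀ k, t k ≠ 0) (hAe : ∀ k, A k e = q (t k)) :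
    ∃ L : E →L[ℝ] E, (∀ p, fderiv ℝ h p (L p) = 0) ∧ L e = v := by
  have : CompleteSpace E := FiniteDimensional.complete ℝ E
  let K : Submodule ℝ (E →L[ℝ] E) :=
    { carrier := {L | (∀ p, fderiv ℝ h p (L p) = 0) ∧ L e = 0}
      add_mem' := fun {a b} ha hb => ⟨fun p => by simp [ha.1 p, hb.1 p], by simp [ha.2, hb.2]⟩
      zero_mem' := by simp
      smul_mem' := fun c a ha => ⟨fun p => by simp [ha.1 p], by simp [ha.2]⟩ }
  obtain ⟨C, hKC⟩ := K.exists_isCompl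
  obtain ⟨g, hg0, hg⟩ := exists_factor_one_add_mul_exp hKC.symm
  let Y : ℕ → C := fun k => (g (A k)).1
  have hY : Tendsto Y atTop (𝓝 0) := (continuous_fst.tendsto (0 : C × K)).comp (hg0.comp hA)
  have hfac : ∀ᶠ k in atTop, 1 + (Y k : E →L[ℝ] E) =
      A k * NormedSpace.exp (-(g (A k)).2 : E →L[ℝ] E) := by
    filter_upwards [hA.eventually hg] with k hk
    let : NormedAlgebra ℚ (E →L[ℝ] E) := NormedAlgebra.restrictScalars ℚ ℝ _
    rw [← hk, mul_assoc, hk, ← NormedSpace.exp_add_of_commute (Commute.neg_right rfl)]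
    simp [Y]
  have hYinv : ∀ᶠ k in atTop, ∀ p, h (p + (Y k : E →L[ℝ] E) p) = h p := by
    filter_upwards [hfac] with k hk p
    have hp := DFunLike.congr_fun hk p
    simp only [add_apply, one_apply_eq_self, mul_apply_eq_comp] at hp
    rw [hp, hAh]
    exact apply_exp_eq_of_fderiv_apply_eq_zero hd (fun p => by simp [(g (A k)).2.2.1 p]) p
  have hYe : ∀ᶠ k in atTop, (Y k : E →L[ℝ] E) e = q (t k) - q 0 := by
    filter_upwards [hfac] with k hk
    have hp := DFunLike.congr_fun hk e
    simp only [add_apply, one_apply_eq_self, mul_apply_eq_comp] at hp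
    rw [exp_apply_eq_of_apply_eq_zero (by simp [(g (A k)).2.2.2]), hAe] at hp
    rw [← hp, hq0]; simp
  let z : ℕ → (E →L[ℝ] E) × ℝ := fun k => (Y k, t k)
  have hz0 (k : ℕ) : z k ≠ 0 := fun hz => ht0 k (congrArg Prod.snd hz)
  have hu (k : ℕ) : ‖z k‖⁻¹ • z k ∈ Metric.sphere (0 : (E →L[ℝ] E) × ℝ) 1 := by
    rw [mem_sphere_zero_iff_norm, norm_smul, norm_inv, norm_norm,
      inv_mul_cancel₀ (norm_ne_zero_iff.2 (hz0 k))]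
  obtain ⟨⟨L, τ⟩, hLτ, φ, hφ, hlim⟩ := (isCompact_sphere (0 : (E →L[ℝ] E) × ℝ) 1).tendsto_subseq hu
  have hL : Tendsto (fun k => ‖z (φ k)‖⁻¹ • (Y (φ k) : E →L[ℝ] E)) atTop (𝓝 L) :=
    (continuous_fst.tendsto (L, τ)).comp hlim
  have hτ : Tendsto (fun k => ‖z (φ k)‖⁻¹ • t (φ k)) atTop (𝓝 τ) :=
    (continuous_snd.tendsto (L, τ)).comp hlim
  have hLC : L ∈ C := C.closed_of_finiteDimensional.mem_of_tendsto hL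
    (Eventually.of_forall fun k => C.smul_mem _ (Y (φ k)).2)
  have hYφ : Tendsto (fun k => (Y (φ k) : E →L[ℝ] E)) atTop (𝓝 0) :=
    ((continuous_subtype_val.tendsto (0 : C)).comp hY).comp hφ.tendsto_atTop
  have hLinv := fderiv_apply_eq_zero_of_tendsto hd hYφ hL (hφ.tendsto_atTop.eventually hYinv)
  have hLe : L e = τ • v := by
    have h1 : Tendsto (fun k => ‖z (φ k)‖⁻¹ • (Y (φ k) : E →L[ℝ] E) e) atTop (𝓝 (L e)) :=
      ((ContinuousLinearMap.apply ℝ E e).continuous.tendsto _).comp hL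
    have h2 := (hasFDerivWithinAt_univ.2 hq.hasFDerivAt).lim (ht.comp hφ.tendsto_atTop)
      (Eventually.of_forall fun _ => Set.mem_univ _) hτ
    refine tendsto_nhds_unique (h1.congr' ?_) (by simpa using h2)
    filter_upwards [hφ.tendsto_atTop.eventually hYe] with k hk
    simp [hk]
  have hτ0 : τ ≠ 0 := by
    rintro rfl
    have hL0 : L = 0 := Submodule.disjoint_def.1 hKC.disjoint _ ⟨hLinv, by simpa using hLe⟩ hLC
    simp [hL0] at hLτ
  refine ⟨τ⁻¹ • L, fun p => by simp [hLinv p], ?_⟩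
  simp [hLe, smul_smul, hτ0]

theorem abs_hessBilin_sub_le {E : Type*} [NormedAddCommGroup E] [NormedSpace ℝ E] (f : E → ℝ)
    (p q w : E) : |hessBilin f q w w - hessBilin f p w w| ≤
      ‖iteratedFDeriv ℝ 2 f q - iteratedFDeriv ℝ 2 f p‖ * ‖w‖ ^ 2 := by
  have := (iteratedFDeriv ℝ 2 f q - iteratedFDeriv ℝ 2 f p).le_opNorm ![w, w]
  simpa [Fin.prod_univ_two, hessBilin, sq] using this

theorem abs_hessBilin_le {E : Type*} [NormedAddCommGroup E] [NormedSpace ℝ E] (f : E → ℝ)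
    (p w : E) : |hessBilin f p w w| ≤ ‖iteratedFDeriv ℝ 2 f p‖ * ‖w‖ ^ 2 := by
  have := (iteratedFDeriv ℝ 2 f p).le_opNorm ![w, w]
  simpa [Fin.prod_univ_two, hessBilin, sq] using this

/-- If the Hessian is negative definite on `S` at some point, then it stays so nearby. -/
theorem eventually_hessBilin_le {E : Type*} [NormedAddCommGroup E] [NormedSpace ℝ E]
    {f : E → ℝ} (hd : ContDiff ℝ 2 f) {e : E} {c : ℝ} (hc : 0 < c) {S : Set E}
    (hS : ∀ w ∈ S, hessBilin f e w w ≤ -c * ‖w‖ ^ 2) :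
    ∀ᶠ q in nhds e, ∀ w ∈ S, hessBilin f q w w ≤ -(c / 2) * ‖w‖ ^ 2 := by
  have h1 := tendsto_iff_norm_sub_tendsto_zero.1
    ((hd.continuous_iteratedFDeriv (m := 2) (by norm_num)).tendsto e)
  filter_upwards [h1.eventually (gt_mem_nhds (half_pos hc))] with q hq w hw
  nlinarith [hS w hw, (abs_le.1 (abs_hessBilin_sub_le f e q w)).2,
    mul_le_mul_of_nonneg_right hq.le (sq_nonneg ‖w‖)]

/-- The Hessian of `f` is preserved by linear automorphisms of `f`. -/
theorem hessBilin_apply_of_comp_eq {E : Type*} [NormedAddCommGroup E] [NormedSpace ℝ E]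
    {f : E → ℝ} (hd : ContDiff ℝ 2 f) {A : E →L[ℝ] E} (hA : ∀ p, f (A p) = f p) (p u w : E) :
    hessBilin f (A p) (A u) (A w) = hessBilin f p u w := by
  have h1 := A.iteratedFDeriv_comp_right hd p (i := 2) (by norm_num)
  rw [show f ∘ A = f from funext hA] at h1
  unfold hessBilin
  rw [h1, ContinuousMultilinearMap.compContinuousLinearMap_apply]
  congr 1
  ext i
  fin_cases i <;> rfl

/-- The Hessian on the diagonal is the second derivative along a line. -/
theorem hessBilin_self_eq_of_hasDerivAt {E : Type*} [NormedAddCommGroup E] [NormedSpace ℝ E]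
    {f : E → ℝ} (hd : ContDiff ℝ 2 f) {p w : E} {d : ℝ → ℝ} {D : ℝ}
    (h1 : ∀ s : ℝ, HasDerivAt (fun s : ℝ => f (p + s • w)) (d s) s) (h2 : HasDerivAt d D 0) :
    hessBilin f p w w = D := by
  have hd1 : Differentiable ℝ (fderiv ℝ f) :=
    (hd.fderiv_right (m := 1) (by norm_num)).differentiable (by norm_num)
  have hline (s : ℝ) : HasDerivAt (fun s : ℝ => p + s • w) w s := by
    have := ((hasDerivAt_id s).smul_const w).const_add p
    rwa [one_smul] at this
  have h3 (s : ℝ) : fderiv ℝ f (p + s • w) w = d s :=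
    ((hd.differentiable (by norm_num) _).hasFDerivAt.comp_hasDerivAt s (hline s)).unique (h1 s)
  have h4 : HasDerivAt (fun s : ℝ => fderiv ℝ f (p + s • w) w)
      (fderiv ℝ (fderiv ℝ f) (p + (0 : ℝ) • w) w w) 0 :=
    (ContinuousLinearMap.apply ℝ ℝ w).hasFDerivAt.comp_hasDerivAt (0 : ℝ)
      ((hd1 _).hasFDerivAt.comp_hasDerivAt (0 : ℝ) (hline 0))
  simp only [h3] at h4
  have h5 := h4.unique h2
  rw [zero_smul, add_zero] at h5
  rw [← h5, hessBilin, iteratedFDeriv_two_apply]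
  rfl

open Filter Topology in
/-- Let some function of `h` have negative definite Hessian at `e`. If automorphisms `A k` of `h`
move `e` to points tending to `e`, then after passing to a subsequence they can be replaced by
automorphisms tending to the identity. -/
theorem exists_automorphism_tendsto_one {E : Type*} [NormedAddCommGroup E] [NormedSpace ℝ E]
    [FiniteDimensional ℝ E] {h : E → ℝ} (hh : Continuous h) {ψ : ℝ → ℝ}
    (hd : ContDiff ℝ 2 fun p => ψ (h p)) {e : E} {c : ℝ} (hc : 0 < c)
    (hneg : ∀ w, hessBilin (fun p => ψ (h p)) e w w ≤ -c * ‖w‖ ^ 2) {A : ℕ → E →L[ℝ] E}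
    (hA : ∀ k p, h (A k p) = h p) (hAe : Tendsto (fun k => A k e) atTop (𝓝 e)) :
    ∃ (B : ℕ → E →L[ℝ] E) (φ : ℕ → ℕ), StrictMono φ ∧ Tendsto B atTop (𝓝 1) ∧
      (∀ k p, h (B k p) = h p) ∧ ∀ k, B k e = A (φ k) e := by
  set F : E → ℝ := fun p => ψ (h p)
  have hAF (M : E →L[ℝ] E) (hM : ∀ p, h (M p) = h p) (p : E) : F (M p) = F p := by simp [F, hM]
  have hinj (M : E →L[ℝ] E) (hM : ∀ p, h (M p) = h p) (hMe : M e = e) :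
      Function.Injective M := by
    refine (injective_iff_map_eq_zero M).2 fun w hw => ?_
    have h1 := hessBilin_apply_of_comp_eq hd (hAF M hM) e w w
    have h3 := abs_hessBilin_le F (M e) (0 : E)
    rw [norm_zero, zero_pow two_ne_zero, mul_zero] at h3
    rw [hw, abs_eq_zero.1 (le_antisymm h3 (abs_nonneg _))] at h1
    have h2 : ‖w‖ ^ 2 ≤ 0 := by
      by_contra! h0
      have := hneg w
      rw [← h1] at this
      nlinarith [mul_pos hc h0]
    simpa using le_antisymm h2 (sq_nonneg _)
  have hbound : ∀ᶠ k in atTop, A k ∈ Metric.closedBall (0 : E →L[ℝ] E)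
      (Real.sqrt (‖iteratedFDeriv ℝ 2 F e‖ / (c / 2))) := by
    filter_upwards [hAe.eventually (eventually_hessBilin_le (S := Set.univ) hd hc
      fun w _ => hneg w)] with k hk
    rw [mem_closedBall_zero_iff]
    refine ContinuousLinearMap.opNorm_le_bound _ (Real.sqrt_nonneg _) fun w => ?_
    have h1 := hk (A k w) trivial
    rw [hessBilin_apply_of_comp_eq hd (hAF _ (hA k))] at h1
    have h2 := (abs_le.1 (abs_hessBilin_le F e w)).1
    refine le_of_sq_le_sq ?_ (by positivity)
    rw [mul_pow, Real.sq_sqrt (by positivity), div_mul_eq_mul_div, le_div_iff₀ (half_pos hc)]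
    nlinarith
  obtain ⟨M, -, φ, hφ, hlim⟩ := Metric.isBounded_closedBall.isCompact_closure.tendsto_subseq'
    (hbound.mono fun k hk => subset_closure hk).frequently
  have happ (p : E) : Tendsto (fun k => A (φ k) p) atTop (𝓝 (M p)) :=
    ((ContinuousLinearMap.apply ℝ E p).continuous.tendsto M).comp hlim
  have hMh (p : E) : h (M p) = h p :=
    tendsto_nhds_unique ((hh.tendsto _).comp (happ p))
      (tendsto_const_nhds.congr fun k => (hA (φ k) p).symm)
  have hMe : M e = e := tendsto_nhds_unique (happ e) (hAe.comp hφ.tendsto_atTop)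
  let N : E ≃L[ℝ] E :=
    (LinearEquiv.ofInjectiveEndo (M : E →ₗ[ℝ] E) (hinj M hMh hMe)).toContinuousLinearEquiv
  have hN (p : E) : N p = M p := rfl
  have hMN (p : E) : M (N.symm p) = p := by rw [← hN, N.apply_symm_apply]
  have hNe : N.symm e = e := by rw [N.symm_apply_eq, hN, hMe]
  refine ⟨fun k => A (φ k) * (N.symm : E →L[ℝ] E), φ, hφ, ?_, fun k p => ?_, fun k => ?_⟩
  · have h1 : M * (N.symm : E →L[ℝ] E) = 1 := by
      ext p
      simp [hMN]
    rw [← h1]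
    exact hlim.mul_const _
  · simp only [mul_apply_eq_comp, ContinuousLinearEquiv.coe_coe]
    rw [hA, ← hMh, hMN]
  · simp [hNe]

open Filter Topology in
/-- If linear automorphisms of `h` move `e` to all points near `e` of a differentiable curve, then
the velocity of the curve at `e` is the value at `e` of an infinitesimal automorphism of `h`. -/
theorem exists_infinitesimal_automorphism_of_eventually {E : Type*} [NormedAddCommGroup E]
    [NormedSpace ℝ E] [FiniteDimensional ℝ E] {h : E → ℝ} (hh : Differentiable ℝ h) {ψ : ℝ → ℝ}
    (hd : ContDiff ℝ 2 fun p => ψ (h p)) {e v : E} {c : ℝ} (hc : 0 < c)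
    (hneg : ∀ w, hessBilin (fun p => ψ (h p)) e w w ≤ -c * ‖w‖ ^ 2) {q : ℝ → E}
    (hq : HasDerivAt q v 0) (hq0 : q 0 = e)
    (hhom : ∀ᶠ t in 𝓝 (0 : ℝ), ∃ A : E ≃ₗ[ℝ] E, (∀ p, h (A p) = h p) ∧ A e = q t) :
    ∃ L : E →L[ℝ] E, (∀ p, fderiv ℝ h p (L p) = 0) ∧ L e = v := by
  obtain ⟨ε, hε, hmem⟩ := Metric.eventually_nhds_iff_ball.1 hhom
  let t : ℕ → ℝ := fun k => ε / 2 * (1 / ((k : ℝ) + 1))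
  have ht0 (k : ℕ) : 0 < t k := by positivity
  have htend : Tendsto t atTop (𝓝 0) := by
    have := (tendsto_one_div_add_atTop_nhds_zero_nat (𝕜 := ℝ)).const_mul (ε / 2)
    rwa [mul_zero] at this
  have htε (k : ℕ) : t k ∈ Metric.ball (0 : ℝ) ε := by
    have : 1 / ((k : ℝ) + 1) ≤ 1 := by
      rw [div_le_one (by positivity)]
      simp
    rw [mem_ball_zero_iff, Real.norm_of_nonneg (ht0 k).le]
    calc t k ≤ ε / 2 * 1 := mul_le_mul_of_nonneg_left this (half_pos hε).le
      _ < ε := by linarith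
  choose A hA hAq using fun k => hmem (t k) (htε k)
  have hAe : Tendsto (fun k => A k e) atTop (𝓝 e) := by
    simp only [hAq]
    have h1 := hq.continuousAt.tendsto.comp htend
    rwa [hq0] at h1
  obtain ⟨B, φ, hφ, hB1, hB, hBe⟩ := exists_automorphism_tendsto_one hh.continuous hd hc hneg
    (A := fun k => ((A k).toContinuousLinearEquiv : E →L[ℝ] E)) hA hAe
  refine exists_infinitesimal_automorphism hh hq hq0 hB1 hB (htend.comp hφ.tendsto_atTop)
    (fun k => (ht0 (φ k)).ne') fun k => ?_
  rw [hBe]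
  exact hAq (φ k)

/-- The quartic `x⁴ - x²⟨y,y⟩ + x f(y) + g(y)`. -/
def quartic {n : ℕ} (f g : (Fin n → ℝ) → ℝ) (p : ℝ × (Fin n → ℝ)) : ℝ :=
  p.1 ^ 4 - p.1 ^ 2 * (∑ i, p.2 i * p.2 i) + p.1 * f p.2 + g p.2

theorem contDiff_quartic {n : ℕ} {f g : (Fin n → ℝ) → ℝ} (hf : ContDiff ℝ 2 f)
    (hg : ContDiff ℝ 2 g) : ContDiff ℝ 2 (quartic f g) := by
  unfold quartic
  fun_prop

theorem quartic_one_zero {n : ℕ} {f g : (Fin n → ℝ) → ℝ}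
    (hf3 : ∀ (c : ℝ) y, f (c • y) = c ^ 3 * f y) (hg4 : ∀ (c : ℝ) y, g (c • y) = c ^ 4 * g y) :
    quartic f g (1, 0) = 1 := by
  have hf00 : f 0 = 0 := by simpa using hf3 0 0
  have hg00 : g 0 = 0 := by simpa using hg4 0 0
  simp [quartic, hf00, hg00]

theorem hasFDerivAt_sum_mul_self {n : ℕ} (y : Fin n → ℝ) :
    HasFDerivAt (fun y : Fin n → ℝ => ∑ i, y i * y i)
      (∑ i, (2 * y i) • ContinuousLinearMap.proj (R := ℝ) (φ := fun _ : Fin n => ℝ) i) y := by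
  refine HasFDerivAt.fun_sum fun i _ => ?_
  have h := (ContinuousLinearMap.proj (R := ℝ) (φ := fun _ : Fin n => ℝ) i).hasFDerivAt (x := y)
  refine (h.mul h).congr_fderiv ?_
  ext u
  simp
  ring

theorem fderiv_quartic {n : ℕ} {f g : (Fin n → ℝ) → ℝ} (hf : Differentiable ℝ f)
    (hg : Differentiable ℝ g) (x : ℝ) (y : Fin n → ℝ) (ξ : ℝ) (η : Fin n → ℝ) :
    fderiv ℝ (quartic f g) (x, y) (ξ, η) =
      (4 * x ^ 3 - 2 * x * (∑ i, y i * y i) + f y) * ξ - 2 * x ^ 2 * (∑ i, y i * η i) +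
        x * fderiv ℝ f y η + fderiv ℝ g y η := by
  have h1 : HasFDerivAt (fun p : ℝ × (Fin n → ℝ) => p.1) (ContinuousLinearMap.fst ℝ ℝ _) (x, y) :=
    hasFDerivAt_fst
  have h2 : HasFDerivAt (fun p : ℝ × (Fin n → ℝ) => p.2) (ContinuousLinearMap.snd ℝ ℝ _) (x, y) :=
    hasFDerivAt_snd
  have hs := (hasFDerivAt_sum_mul_self y).comp (x, y) h2
  have hF := (hf y).hasFDerivAt.comp (x, y) h2
  have hG := (hg y).hasFDerivAt.comp (x, y) h2
  have h := ((((h1.pow 4).sub ((h1.pow 2).mul hs)).add (h1.mul hF)).add hG).fderiv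
  have h' := DFunLike.congr_fun h (ξ, η)
  refine Eq.trans (congrArg (fun F => fderiv ℝ F (x, y) (ξ, η)) ?_) (h'.trans ?_)
  · rfl
  · simp [mul_assoc, ← Finset.mul_sum]
    ring

/-- Euler's identity along a ray. -/
theorem fderiv_smul_apply_self {E : Type*} [NormedAddCommGroup E] [NormedSpace ℝ E] {f : E → ℝ}
    (hf : Differentiable ℝ f) {k : ℕ} (hk : ∀ (c : ℝ) y, f (c • y) = c ^ k * f y) (s : ℝ) (y : E) :
    fderiv ℝ f (s • y) y = k * s ^ (k - 1) * f y := by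
  have h1 : HasDerivAt (fun s : ℝ => f (s • y)) (fderiv ℝ f (s • y) y) s := by
    refine (hf _).hasFDerivAt.comp_hasDerivAt s ?_
    simpa using (hasDerivAt_id s).smul_const y
  simp only [hk] at h1
  exact h1.unique ((hasDerivAt_pow k s).mul_const (f y))

theorem quartic_line {n : ℕ} {f g : (Fin n → ℝ) → ℝ}
    (hf3 : ∀ (c : ℝ) y, f (c • y) = c ^ 3 * f y) (hg4 : ∀ (c : ℝ) y, g (c • y) = c ^ 4 * g y)
    (w : ℝ × (Fin n → ℝ)) (s : ℝ) : quartic f g ((1, 0) + s • w) =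
      (1 + s * w.1) ^ 4 - (1 + s * w.1) ^ 2 * (s ^ 2 * ∑ i, w.2 i * w.2 i) +
        (1 + s * w.1) * (s ^ 3 * f w.2) + s ^ 4 * g w.2 := by
  have hsum : ∑ i, (s • w.2) i * (s • w.2) i = s ^ 2 * ∑ i, w.2 i * w.2 i := by
    rw [Finset.mul_sum]
    exact Finset.sum_congr rfl fun i _ => by simp; ring
  simp only [quartic, Prod.fst_add, Prod.snd_add, Prod.smul_fst, Prod.smul_snd, zero_add, hf3, hg4,
    hsum, smul_eq_mul]

/-- The quartic has along lines through `(1, 0)` an explicit two-jet. -/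
theorem exists_hasDerivAt_quartic_line {n : ℕ} {f g : (Fin n → ℝ) → ℝ}
    (hf3 : ∀ (c : ℝ) y, f (c • y) = c ^ 3 * f y) (hg4 : ∀ (c : ℝ) y, g (c • y) = c ^ 4 * g y)
    (w : ℝ × (Fin n → ℝ)) : ∃ d : ℝ → ℝ,
      (∀ s, HasDerivAt (fun s : ℝ => quartic f g ((1, 0) + s • w)) (d s) s) ∧ d 0 = 4 * w.1 ∧
        HasDerivAt d (12 * w.1 ^ 2 - 2 * ∑ i, w.2 i * w.2 i) 0 := by
  obtain ⟨x, y⟩ := w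
  simp only [quartic_line hf3 hg4]
  generalize f y = a, g y = b, ∑ i, y i * y i = S
  let P : Polynomial ℝ := (1 + Polynomial.X * Polynomial.C x) ^ 4 -
    (1 + Polynomial.X * Polynomial.C x) ^ 2 * (Polynomial.X ^ 2 * Polynomial.C S) +
    (1 + Polynomial.X * Polynomial.C x) * (Polynomial.X ^ 3 * Polynomial.C a) +
    Polynomial.X ^ 4 * Polynomial.C b
  refine ⟨fun s => P.derivative.eval s, fun s => ?_, ?_, ?_⟩
  · refine (P.hasDerivAt s).congr_of_eventuallyEq (Filter.Eventually.of_forall fun t => ?_)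
    simp [P]
    ring
  · simp [P, Polynomial.derivative_pow]
  · refine (P.derivative.hasDerivAt 0).congr_deriv ?_
    simp [P, Polynomial.derivative_pow]
    ring

theorem hessBilin_quartic {n : ℕ} {f g : (Fin n → ℝ) → ℝ} (hf : ContDiff ℝ 2 f)
    (hg : ContDiff ℝ 2 g) (hf3 : ∀ (c : ℝ) y, f (c • y) = c ^ 3 * f y)
    (hg4 : ∀ (c : ℝ) y, g (c • y) = c ^ 4 * g y) (w : ℝ × (Fin n → ℝ)) :
    hessBilin (quartic f g) (1, 0) w w = 12 * w.1 ^ 2 - 2 * ∑ i, w.2 i * w.2 i := by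
  obtain ⟨d, h1, -, h2⟩ := exists_hasDerivAt_quartic_line hf3 hg4 w
  exact hessBilin_self_eq_of_hasDerivAt (contDiff_quartic hf hg) h1 h2

theorem contDiff_two_mul_sub_sq {E : Type*} [NormedAddCommGroup E] [NormedSpace ℝ E] {h : E → ℝ}
    (hd : ContDiff ℝ 2 h) : ContDiff ℝ 2 fun p => 2 * h p - h p ^ 2 / 2 := by
  fun_prop

theorem norm_snd_sq_le_sum {n : ℕ} (y : Fin n → ℝ) : ‖y‖ ^ 2 ≤ ∑ i, y i * y i := by
  have h0 : 0 ≤ ∑ i, y i * y i := Finset.sum_nonneg fun i _ => mul_self_nonneg _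
  have h1 : ‖y‖ ≤ Real.sqrt (∑ i, y i * y i) := by
    refine (pi_norm_le_iff_of_nonneg (Real.sqrt_nonneg _)).2 fun i => Real.abs_le_sqrt ?_
    rw [sq]
    exact Finset.single_le_sum (f := fun i => y i * y i) (fun i _ => mul_self_nonneg _)
      (Finset.mem_univ i)
  calc ‖y‖ ^ 2 ≤ Real.sqrt (∑ i, y i * y i) ^ 2 := by gcongr
    _ = _ := Real.sq_sqrt h0

/-- The function `2 h - h² / 2` of the quartic `h` has negative definite Hessian at `(1, 0)`. -/
theorem hessBilin_two_mul_sub_sq_quartic_le {n : ℕ} {f g : (Fin n → ℝ) → ℝ}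
    (hf : ContDiff ℝ 2 f) (hg : ContDiff ℝ 2 g) (hf3 : ∀ (c : ℝ) y, f (c • y) = c ^ 3 * f y)
    (hg4 : ∀ (c : ℝ) y, g (c • y) = c ^ 4 * g y) (w : ℝ × (Fin n → ℝ)) :
    hessBilin (fun p => 2 * quartic f g p - quartic f g p ^ 2 / 2) (1, 0) w w ≤
      -2 * ‖w‖ ^ 2 := by
  obtain ⟨d, h1, hd0, h2⟩ := exists_hasDerivAt_quartic_line hf3 hg4 w
  have h3 (s : ℝ) :=
    ((h1 s).const_mul 2).sub (((h1 s).pow 2).div_const 2)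
  have h4 := (h2.const_mul 2).sub (((((h1 0).pow (2 - 1)).const_mul ((2 : ℕ) : ℝ)).mul
    h2).div_const 2)
  rw [hessBilin_self_eq_of_hasDerivAt (contDiff_two_mul_sub_sq (contDiff_quartic hf hg)) h3 h4]
  have h5 := norm_snd_sq_le_sum w.2
  have h6 : ‖w.1‖ ^ 2 = w.1 ^ 2 := by simp
  have h7 : ‖w‖ ^ 2 ≤ ‖w.1‖ ^ 2 + ‖w.2‖ ^ 2 := by
    rcases max_cases ‖w.1‖ ‖w.2‖ with h | h <;> rw [Prod.norm_def, h.1] <;>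
      nlinarith [sq_nonneg ‖w.1‖, sq_nonneg ‖w.2‖]
  simp [quartic_one_zero hf3 hg4, hd0]
  nlinarith [sq_nonneg w.1]

theorem eventually_isHyperbolicPt_quartic {n : ℕ} {f g : (Fin n → ℝ) → ℝ} (hf : ContDiff ℝ 2 f)
    (hg : ContDiff ℝ 2 g) (hf3 : ∀ (c : ℝ) y, f (c • y) = c ^ 3 * f y)
    (hg4 : ∀ (c : ℝ) y, g (c • y) = c ^ 4 * g y) :
    ∀ᶠ q in nhds ((1, 0) : ℝ × (Fin n → ℝ)), IsHyperbolicPt n (quartic f g) q := by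
  have hpos : ∀ᶠ q in nhds ((1, 0) : ℝ × (Fin n → ℝ)),
      0 < hessBilin (quartic f g) q (1, 0) (1, 0) := by
    have h1 : Continuous fun q => hessBilin (quartic f g) q (1, 0) (1, 0) :=
      (ContinuousMultilinearMap.apply ℝ _ ℝ ![((1, 0) : ℝ × (Fin n → ℝ)), (1, 0)]).continuous.comp
        ((contDiff_quartic hf hg).continuous_iteratedFDeriv (m := 2) (by norm_num))
    refine h1.continuousAt.eventually (lt_mem_nhds ?_)
    simp [hessBilin_quartic hf hg hf3 hg4]
  let W : Submodule ℝ (ℝ × (Fin n → ℝ)) := LinearMap.range (LinearMap.inr ℝ ℝ (Fin n → ℝ))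
  have hneg := eventually_hessBilin_le (contDiff_quartic hf hg) (e := (1, 0)) two_pos
    (S := W) (by
      rintro _ ⟨y, rfl⟩
      rw [hessBilin_quartic hf hg hf3 hg4]
      have := norm_snd_sq_le_sum y
      simp
      linarith)
  filter_upwards [hpos, hneg] with q hq1 hq2
  refine ⟨(1, 0), W, ?_, ?_, ?_, fun w hw hw0 => ?_⟩
  · rw [LinearMap.finrank_range_of_inj LinearMap.inr_injective]
    simp
  · constructor
    · rw [Submodule.disjoint_def]
      rintro _ hx ⟨y, rfl⟩
      obtain ⟨c, hc⟩ := Submodule.mem_span_singleton.1 hx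
      have := congrArg Prod.snd hc
      simp at this
      simp [← this]
    · rw [codisjoint_iff, eq_top_iff]
      rintro ⟨x, y⟩ -
      exact Submodule.mem_sup.2 ⟨(x, 0), Submodule.mem_span_singleton.2 ⟨x, by simp⟩, (0, y),
        ⟨y, rfl⟩, by simp⟩
  · exact hq1
  · have := hq2 w hw
    have h0 : 0 < ‖w‖ ^ 2 := by positivity
    linarith

theorem quartic_smul {n : ℕ} {f g : (Fin n → ℝ) → ℝ}
    (hf3 : ∀ (c : ℝ) y, f (c • y) = c ^ 3 * f y) (hg4 : ∀ (c : ℝ) y, g (c • y) = c ^ 4 * g y)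
    (c : ℝ) (p : ℝ × (Fin n → ℝ)) : quartic f g (c • p) = c ^ 4 * quartic f g p := by
  have hsum : ∑ i, (c • p).2 i * (c • p).2 i = c ^ 2 * ∑ i, p.2 i * p.2 i := by
    rw [Finset.mul_sum]
    exact Finset.sum_congr rfl fun i _ => by simp; ring
  unfold quartic
  rw [hsum, Prod.smul_snd, Prod.smul_fst, hf3, hg4, smul_eq_mul]
  ring

/-- The curve obtained by projecting the line `(1, t v)` radially to the level set
`quartic f g = 1`. -/
def levelCurve {n : ℕ} (f g : (Fin n → ℝ) → ℝ) (v : Fin n → ℝ) (t : ℝ) : ℝ × (Fin n → ℝ) :=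
  (quartic f g (1, t • v)) ^ (-(1 / 4) : ℝ) • (1, t • v)

theorem quartic_levelCurve {n : ℕ} {f g : (Fin n → ℝ) → ℝ}
    (hf3 : ∀ (c : ℝ) y, f (c • y) = c ^ 3 * f y) (hg4 : ∀ (c : ℝ) y, g (c • y) = c ^ 4 * g y)
    {v : Fin n → ℝ} {t : ℝ} (ht : 0 < quartic f g (1, t • v)) :
    quartic f g (levelCurve f g v t) = 1 := by
  rw [levelCurve, quartic_smul hf3 hg4, ← Real.rpow_natCast, ← Real.rpow_mul ht.le]
  norm_num
  rw [Real.rpow_neg_one, inv_mul_cancel₀ ht.ne']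

theorem levelCurve_zero {n : ℕ} {f g : (Fin n → ℝ) → ℝ}
    (hf3 : ∀ (c : ℝ) y, f (c • y) = c ^ 3 * f y) (hg4 : ∀ (c : ℝ) y, g (c • y) = c ^ 4 * g y)
    (v : Fin n → ℝ) : levelCurve f g v 0 = (1, 0) := by
  simp [levelCurve, quartic_one_zero hf3 hg4]

theorem hasDerivAt_levelCurve {n : ℕ} {f g : (Fin n → ℝ) → ℝ} (hf : ContDiff ℝ 2 f)
    (hg : ContDiff ℝ 2 g) (hf3 : ∀ (c : ℝ) y, f (c • y) = c ^ 3 * f y)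
    (hg4 : ∀ (c : ℝ) y, g (c • y) = c ^ 4 * g y) (v : Fin n → ℝ) :
    HasDerivAt (levelCurve f g v) (0, v) 0 := by
  have hfd := hf.differentiable (by norm_num)
  have hgd := hg.differentiable (by norm_num)
  have hline : HasDerivAt (fun t : ℝ => ((1, t • v) : ℝ × (Fin n → ℝ))) (0, v) 0 := by
    refine (hasDerivAt_const _ _).prodMk ?_
    simpa using (hasDerivAt_id (0 : ℝ)).smul_const v
  have hr : HasDerivAt (fun t : ℝ => quartic f g (1, t • v)) 0 0 := by
    have h1 := ((contDiff_quartic hf hg).differentiable (by norm_num)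
      (1, (0 : ℝ) • v)).hasFDerivAt.comp_hasDerivAt (0 : ℝ) hline
    have hg0 : fderiv ℝ g 0 v = 0 := by simpa using fderiv_smul_apply_self hgd hg4 0 v
    have hf0 : fderiv ℝ f 0 v = 0 := by simpa using fderiv_smul_apply_self hfd hf3 0 v
    refine HasDerivAt.congr_deriv (f := fun t : ℝ => quartic f g (1, t • v)) h1 ?_
    rw [fderiv_quartic hfd hgd]
    simp [hg0, hf0]
  have h := (hr.rpow_const (p := -(1 / 4))
    (Or.inl (by simp [quartic_one_zero hf3 hg4]))).smul hline
  refine HasDerivAt.congr_deriv (f := levelCurve f g v) h ?_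
  simp [quartic_one_zero hf3 hg4]

open Filter Topology in
theorem eventually_levelCurve_mem {n : ℕ} {f g : (Fin n → ℝ) → ℝ} (hf : ContDiff ℝ 2 f)
    (hg : ContDiff ℝ 2 g) (hf3 : ∀ (c : ℝ) y, f (c • y) = c ^ 3 * f y)
    (hg4 : ∀ (c : ℝ) y, g (c • y) = c ^ 4 * g y) (v : Fin n → ℝ) :
    ∀ᶠ t in 𝓝 (0 : ℝ), levelCurve f g v t ∈
      connectedComponentIn {p | quartic f g p = 1 ∧ IsHyperbolicPt n (quartic f g) p} (1, 0) := by
  have hr : Continuous fun t : ℝ => quartic f g (1, t • v) := by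
    have := (contDiff_quartic hf hg).continuous
    fun_prop
  have hr0 : ∀ᶠ t in 𝓝 (0 : ℝ), 0 < quartic f g (1, t • v) :=
    hr.continuousAt.eventually (lt_mem_nhds (by simp [quartic_one_zero hf3 hg4]))
  have hhyp : ∀ᶠ t in 𝓝 (0 : ℝ), IsHyperbolicPt n (quartic f g) (levelCurve f g v t) := by
    refine (hasDerivAt_levelCurve hf hg hf3 hg4 v).continuousAt.eventually ?_
    rw [levelCurve_zero hf3 hg4]
    exact eventually_isHyperbolicPt_quartic hf hg hf3 hg4
  obtain ⟨ε, hε, hball⟩ := Metric.eventually_nhds_iff_ball.1 (hr0.and hhyp)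
  have hcont : ContinuousOn (levelCurve f g v) (Metric.ball 0 ε) := by
    intro t ht
    refine ContinuousAt.continuousWithinAt ?_
    have h1 : ContinuousAt (fun t : ℝ => (quartic f g (1, t • v)) ^ (-(1 / 4) : ℝ)) t :=
      hr.continuousAt.rpow_const (Or.inl (hball t ht).1.ne')
    exact h1.smul (by fun_prop)
  have hsub := ((convex_ball (0 : ℝ) ε).isPreconnected.image _ hcont).subset_connectedComponentIn
    (x := (1, 0)) (F := {p | quartic f g p = 1 ∧ IsHyperbolicPt n (quartic f g) p})
    ⟨0, Metric.mem_ball_self hε, levelCurve_zero hf3 hg4 v⟩ (by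
      rintro _ ⟨t, ht, rfl⟩
      exact ⟨quartic_levelCurve hf3 hg4 (hball t ht).1, (hball t ht).2⟩)
  filter_upwards [Metric.ball_mem_nhds (0 : ℝ) hε] with t ht
  exact hsub ⟨t, ht, rfl⟩

/-- Homogeneity of the component of `(1, 0)` implies infinitesimal homogeneity at `(1, 0)`. -/
theorem exists_infinitesimal_automorphism_quartic {n : ℕ} {f g : (Fin n → ℝ) → ℝ}
    (hf : ContDiff ℝ 2 f) (hg : ContDiff ℝ 2 g) (hf3 : ∀ (c : ℝ) y, f (c • y) = c ^ 3 * f y)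
    (hg4 : ∀ (c : ℝ) y, g (c • y) = c ^ 4 * g y)
    (hhom : ∀ q ∈ connectedComponentIn
        {p | quartic f g p = 1 ∧ IsHyperbolicPt n (quartic f g) p} (1, 0),
      ∃ A : (ℝ × (Fin n → ℝ)) ≃ₗ[ℝ] (ℝ × (Fin n → ℝ)),
        (∀ v, quartic f g (A v) = quartic f g v) ∧ A (1, 0) = q) (v : Fin n → ℝ) :
    ∃ L : (ℝ × (Fin n → ℝ)) →L[ℝ] (ℝ × (Fin n → ℝ)),
      (∀ p, fderiv ℝ (quartic f g) p (L p) = 0) ∧ L (1, 0) = (0, v) :=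
  exists_infinitesimal_automorphism_of_eventually (ψ := fun s => 2 * s - s ^ 2 / 2)
    ((contDiff_quartic hf hg).differentiable (by norm_num))
    (contDiff_two_mul_sub_sq (contDiff_quartic hf hg)) two_pos
    (hessBilin_two_mul_sub_sq_quartic_le hf hg hf3 hg4) (hasDerivAt_levelCurve hf hg hf3 hg4 v)
    (levelCurve_zero hf3 hg4 v)
    ((eventually_levelCurve_mem hf hg hf3 hg4 v).mono fun _ ht => hhom _ ht)

/-- The equations satisfied at a unit vector by an infinitesimal automorphism of `quartic f g`. -/
theorem exists_infinitesimal_equations {n : ℕ} {f g : (Fin n → ℝ) → ℝ}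
    (hf : Differentiable ℝ f) (hg : Differentiable ℝ g)
    {L : (ℝ × (Fin n → ℝ)) →L[ℝ] (ℝ × (Fin n → ℝ))} {v : Fin n → ℝ}
    (hL : ∀ p, fderiv ℝ (quartic f g) p (L p) = 0) (hLe : L (1, 0) = (0, v))
    {y : Fin n → ℝ} (hy : ∑ i, y i * y i = 1) :
    ∃ η : Fin n → ℝ, fderiv ℝ f y v = 2 * ∑ i, y i * η i ∧
      fderiv ℝ f y η + fderiv ℝ g y v = ∑ i, y i * v i ∧
      f y * (∑ i, y i * v i) + 2 * fderiv ℝ g y η = 0 := by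
  rcases hLy : L (0, y) with ⟨ξ, η⟩
  have hLx (x : ℝ) : L (x, y) = (ξ, x • v + η) := by
    have : ((x, y) : ℝ × (Fin n → ℝ)) = x • (1, 0) + (0, y) := by simp
    rw [this, map_add, map_smul, hLe, hLy]
    simp
  have hx (x : ℝ) := hL (x, y)
  have hsum (x : ℝ) : ∑ i, y i * (x • v + η) i = x * (∑ i, y i * v i) + ∑ i, y i * η i := by
    rw [Finset.mul_sum, ← Finset.sum_add_distrib]
    exact Finset.sum_congr rfl fun i _ => by simp; ring
  simp only [hLx, fderiv_quartic hf hg, hy, hsum, map_add, map_smul, smul_eq_mul] at hx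
  have h0 := hx 0
  have h1 := hx 1
  have h2 := hx (-1)
  have h3 := hx 2
  have h4 := hx (-2)
  have hξ : 2 * ξ = ∑ i, y i * v i := by linarith
  refine ⟨η, by linarith, by linarith, ?_⟩
  rw [← hξ]
  linarith

/-- A function of degree four attains on the unit sphere a maximum, at which its differential is
radial. -/
theorem exists_max_on_sphere {n : ℕ} {g : (Fin n → ℝ) → ℝ} (hg : Differentiable ℝ g)
    (hg4 : ∀ (c : ℝ) y, g (c • y) = c ^ 4 * g y) {y₀ : Fin n → ℝ} (hy₀ : ∑ i, y₀ i * y₀ i = 1) :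
    ∃ y : Fin n → ℝ, ∑ i, y i * y i = 1 ∧ g y₀ ≤ g y ∧
      ∀ u, fderiv ℝ g y u = 4 * g y * ∑ i, y i * u i := by
  have hcomp : IsCompact {y : Fin n → ℝ | ∑ i, y i * y i = 1} := by
    refine Metric.isCompact_of_isClosed_isBounded
      (isClosed_eq (by fun_prop) continuous_const) ?_
    refine (Metric.isBounded_closedBall (x := (0 : Fin n → ℝ)) (r := 1)).subset fun y hy => ?_
    rw [mem_closedBall_zero_iff, ← sq_le_one_iff₀ (norm_nonneg _)]
    exact (norm_snd_sq_le_sum y).trans_eq hy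
  obtain ⟨y, hy, hmax⟩ := hcomp.exists_isMaxOn ⟨y₀, hy₀⟩ hg.continuous.continuousOn
  have hy : ∑ i, y i * y i = 1 := hy
  refine ⟨y, hy, hmax hy₀, fun u => ?_⟩
  have hglob : IsLocalMax (fun z : Fin n → ℝ => g z - g y * (∑ i, z i * z i) ^ 2) y := by
    refine Filter.Eventually.of_forall fun z => ?_
    simp only [hy]
    rcases (Finset.sum_nonneg fun i (_ : i ∈ Finset.univ) => mul_self_nonneg (z i)).eq_or_lt
      with hz | hz
    · have hz0 : z = 0 := by
        have := norm_snd_sq_le_sum z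
        rw [← hz] at this
        simpa using le_antisymm this (sq_nonneg _)
      have : g 0 = 0 := by simpa using hg4 0 0
      simp [hz0, this]
    · set s := ∑ i, z i * z i with hs
      have hc : (Real.sqrt s)⁻¹ ^ 2 = s⁻¹ := by rw [inv_pow, Real.sq_sqrt hz.le]
      have h1 : g ((Real.sqrt s)⁻¹ • z) ≤ g y := by
        refine hmax ?_
        have : ∑ i, ((Real.sqrt s)⁻¹ • z) i * ((Real.sqrt s)⁻¹ • z) i =
            (Real.sqrt s)⁻¹ ^ 2 * s := by
          rw [hs, Finset.mul_sum, ← hs]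
          exact Finset.sum_congr rfl fun i _ => by simp; ring
        simp only [Set.mem_ofPred_eq]
        rw [this, hc, inv_mul_cancel₀ hz.ne']
      rw [hg4, show (Real.sqrt s)⁻¹ ^ 4 = ((Real.sqrt s)⁻¹ ^ 2) ^ 2 by ring, hc, inv_pow,
        inv_mul_le_iff₀ (by positivity)] at h1
      linarith
  have hder := (hg y).hasFDerivAt.sub (((hasFDerivAt_sum_mul_self y).pow 2).const_mul (g y))
  have h0 := DFunLike.congr_fun (hglob.hasFDerivAt_eq_zero hder) u
  simp [hy, mul_assoc, ← Finset.mul_sum] at h0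
  linarith

theorem eval_smul_of_isHomogeneous {n k : ℕ} {P : MvPolynomial (Fin n) ℝ} (hP : P.IsHomogeneous k)
    (c : ℝ) (y : Fin n → ℝ) :
    MvPolynomial.eval (c • y) P = c ^ k * MvPolynomial.eval y P := by
  simp only [MvPolynomial.eval_eq, Finset.mul_sum]
  refine Finset.sum_congr rfl fun d hd => ?_
  have hk : ∑ i, d i = k := by
    have := hP (MvPolynomial.mem_support_iff.1 hd)
    rw [← Finsupp.degree_eq_sum, Finsupp.degree_eq_weight_one]
    exact this
  have h1 : ∏ i ∈ d.support, c ^ d i = c ^ k := by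
    rw [Finset.prod_pow_eq_pow_sum, ← hk]
    congr 1
    exact Finset.sum_subset (Finset.subset_univ _) (by simp)
  simp only [Pi.smul_apply, smul_eq_mul, mul_pow, Finset.prod_mul_distrib, h1]
  ring

/-- Infinitesimal homogeneity bounds the quartic part on the unit sphere. -/
theorem le_of_infinitesimal_equations {n : ℕ} {f g : (Fin n → ℝ) → ℝ}
    (hf : Differentiable ℝ f) (hg : Differentiable ℝ g)
    (hf3 : ∀ (c : ℝ) y, f (c • y) = c ^ 3 * f y) (hg4 : ∀ (c : ℝ) y, g (c • y) = c ^ 4 * g y)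
    (heq : ∀ v y : Fin n → ℝ, ∑ i, y i * y i = 1 →
      ∃ η : Fin n → ℝ, fderiv ℝ f y v = 2 * ∑ i, y i * η i ∧
        fderiv ℝ f y η + fderiv ℝ g y v = ∑ i, y i * v i ∧
        f y * (∑ i, y i * v i) + 2 * fderiv ℝ g y η = 0)
    {y₀ : Fin n → ℝ} (hy₀ : ∑ i, y₀ i * y₀ i = 1) : g y₀ ≤ 1 / 4 := by
  obtain ⟨y, hy, hle, hgy⟩ := exists_max_on_sphere hg hg4 hy₀
  refine hle.trans ?_
  by_contra! hb
  have hfy : fderiv ℝ f y y = 3 * f y := by simpa using fderiv_smul_apply_self hf hf3 1 y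
  obtain ⟨η, h1, h2, h3⟩ := heq y y hy
  rw [hfy] at h1
  rw [hy, hgy, hy] at h2
  rw [hy, hgy] at h3
  have ha : f y = 0 := by
    have : f y * (1 + 12 * g y) = 0 := by linear_combination h3 + 4 * g y * h1
    exact (mul_eq_zero.1 this).resolve_right (by linarith)
  obtain ⟨η₂, h4, -, h6⟩ := heq η y hy
  rw [ha, hgy] at h6
  have h7 : fderiv ℝ f y η = 0 := by
    have : g y * fderiv ℝ f y η = 0 := by linear_combination h6 / 4 + g y * h4
    exact (mul_eq_zero.1 this).resolve_left (by linarith)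
  linarith

/-- The values of `f` and `g` at a point `y` of the unit sphere critical for `f + g`. -/
theorem critical_values_of_infinitesimal_equations {n : ℕ} {f g : (Fin n → ℝ) → ℝ}
    (hf : Differentiable ℝ f) (hg : Differentiable ℝ g)
    (hf3 : ∀ (c : ℝ) y, f (c • y) = c ^ 3 * f y) (hg4 : ∀ (c : ℝ) y, g (c • y) = c ^ 4 * g y)
    (heq : ∀ v y : Fin n → ℝ, ∑ i, y i * y i = 1 →
      ∃ η : Fin n → ℝ, fderiv ℝ f y v = 2 * ∑ i, y i * η i ∧
        fderiv ℝ f y η + fderiv ℝ g y v = ∑ i, y i * v i ∧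
        f y * (∑ i, y i * v i) + 2 * fderiv ℝ g y η = 0)
    {y : Fin n → ℝ} (hy : ∑ i, y i * y i = 1)
    (hcrit : ∀ u : Fin n → ℝ, ∑ i, y i * u i = 0 → fderiv ℝ f y u + fderiv ℝ g y u = 0) :
    (f y = 0 ∧ g y = 1 / 4) ∨ (f y ^ 2 = 8 / 27 ∧ g y = -(1 / 12)) := by
  have hb := le_of_infinitesimal_equations hf hg hf3 hg4 heq hy
  have hfy : fderiv ℝ f y y = 3 * f y := by simpa using fderiv_smul_apply_self hf hf3 1 y
  have hgy : fderiv ℝ g y y = 4 * g y := by simpa using fderiv_smul_apply_self hg hg4 1 y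
  have hproj (η : Fin n → ℝ) : ∑ i, y i * (η - (∑ i, y i * η i) • y) i = 0 := by
    have : ∑ i, y i * (η - (∑ i, y i * η i) • y) i =
        ∑ i, y i * η i - (∑ i, y i * η i) * ∑ i, y i * y i := by
      rw [Finset.mul_sum, ← Finset.sum_sub_distrib]
      exact Finset.sum_congr rfl fun i _ => by simp; ring
    rw [this, hy, mul_one, sub_self]
  obtain ⟨η, h1, h2, h3⟩ := heq y y hy
  rw [hfy] at h1
  rw [hgy, hy] at h2
  rw [hy] at h3
  have hc := hcrit _ (hproj η)
  obtain ⟨η₂, h4, h5, h6⟩ := heq (η - (∑ i, y i * η i) • y) y hy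
  have hc₂ := hcrit _ (hproj η₂)
  rw [hproj] at h5 h6
  simp only [map_sub, map_smul, smul_eq_mul, hfy, hgy] at hc hc₂ h4 h5
  generalize ∑ i, y i * η i = s at *
  generalize ∑ i, y i * η₂ i = s₂ at *
  generalize fderiv ℝ f y η = p, fderiv ℝ g y η = q, fderiv ℝ f y η₂ = p₂,
    fderiv ℝ g y η₂ = q₂, f y = a, g y = b at *
  obtain rfl : s = 3 * a / 2 := by linarith
  have key : s₂ * (1 - 3 * a / 2 - 2 * b) = 0 := by
    linear_combination hc₂ / 2 - h5 / 2 - h6 / 4 + hc / 2 - h4 / 2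
  rcases mul_eq_zero.1 key with h0 | h0
  · rw [h0] at h4
    have hab : a * (1 + 12 * b) = 0 := by linear_combination h3 - 2 * hc + 2 * h4
    rcases mul_eq_zero.1 hab with ha | hb'
    · subst ha
      exact Or.inl ⟨rfl, by linarith⟩
    · obtain rfl : b = -(1 / 12) := by linarith
      exact Or.inr ⟨by linear_combination (2 / 9) * (h2 - h4), rfl⟩
  · obtain rfl : b = 1 / 2 - 3 * a / 4 := by linarith
    have : a = -2 := by linear_combination 2 * h2 + h3 - 2 * hc
    linarith

/-- The derivative of `quartic f g` along the affine hyperplane `x = 1`. -/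
theorem fderiv_quartic_one {n : ℕ} {f g : (Fin n → ℝ) → ℝ} (hf : Differentiable ℝ f)
    (hg : Differentiable ℝ g) (hd : Differentiable ℝ (quartic f g)) (y u : Fin n → ℝ) :
    fderiv ℝ (fun y => quartic f g (1, y)) y u =
      -2 * (∑ i, y i * u i) + fderiv ℝ f y u + fderiv ℝ g y u := by
  have h1 : HasFDerivAt (fun y => quartic f g (1, y))
      (fderiv ℝ (quartic f g) (1, y) ∘L ContinuousLinearMap.inr ℝ ℝ (Fin n → ℝ)) y :=
    (hd (1, y)).hasFDerivAt.comp y (hasFDerivAt_prodMk_right 1 y)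
  rw [h1.fderiv, ContinuousLinearMap.comp_apply, ContinuousLinearMap.inr_apply,
    fderiv_quartic hf hg]
  ring

theorem contDiff_eval {n : ℕ} (P : MvPolynomial (Fin n) ℝ) :
    ContDiff ℝ 2 fun y : Fin n → ℝ => MvPolynomial.eval y P := by
  simp only [MvPolynomial.eval_eq]
  fun_prop

/-- **Critical values for homogeneous quartics in standard form (Corollary 4.2).**
If the quartic GPSR manifold `H` in standard form, with defining polynomial
`h(x,y) = x⁴ − x²⟨y,y⟩ + x·P₃(y) + P₄(y)`, is a homogeneous space under linear automorphisms
of `h`, then every critical point `ȳ ∈ S^{n−1}` of `y ↦ h(1,y)` restricted to the unit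
sphere satisfies `(P₃(ȳ) = 0 and P₄(ȳ) = 1/4)` or `(|P₃(ȳ)| = 2√2/(3√3) and
P₄(ȳ) = −1/12)`. -/
theorem critical_values_homogeneous_quartic (n : ℕ) (hn : 1 ≤ n)
    (P₃ P₄ : MvPolynomial (Fin n) ℝ)
    (h3 : P₃.IsHomogeneous 3) (h4 : P₄.IsHomogeneous 4)
    (h : ℝ × (Fin n → ℝ) → ℝ)
    (hdef : h = fun p => p.1 ^ 4 - p.1 ^ 2 * (∑ i, p.2 i * p.2 i) +
      p.1 * MvPolynomial.eval p.2 P₃ + MvPolynomial.eval p.2 P₄)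
    (H : Set (ℝ × (Fin n → ℝ)))
    (hH : H = connectedComponentIn {p | h p = 1 ∧ IsHyperbolicPt n h p} (1, 0))
    (hhom : ∀ p ∈ H, ∀ q ∈ H, ∃ A : (ℝ × (Fin n → ℝ)) ≃ₗ[ℝ] (ℝ × (Fin n → ℝ)),
      (∀ v, h (A v) = h v) ∧ A p = q) :
    ∀ yb : Fin n → ℝ, (∑ i, yb i * yb i) = 1 →
      (∀ u : Fin n → ℝ, (∑ i, yb i * u i) = 0 →
        fderiv ℝ (fun y => h (1, y)) yb u = 0) →
      (MvPolynomial.eval yb P₃ = 0 ∧ MvPolynomial.eval yb P₄ = 1/4) ∨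
      (|MvPolynomial.eval yb P₃| = 2 * Real.sqrt 2 / (3 * Real.sqrt 3) ∧
        MvPolynomial.eval yb P₄ = -(1/12)) := by
  set f : (Fin n → ℝ) → ℝ := fun y => MvPolynomial.eval y P₃
  set g : (Fin n → ℝ) → ℝ := fun y => MvPolynomial.eval y P₄
  obtain rfl : h = quartic f g := hdef
  have hfc : ContDiff ℝ 2 f := contDiff_eval P₃
  have hgc : ContDiff ℝ 2 g := contDiff_eval P₄
  have hfd : Differentiable ℝ f := hfc.differentiable (by norm_num)
  have hgd : Differentiable ℝ g := hgc.differentiable (by norm_num)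
  have hf3 : ∀ (c : ℝ) y, f (c • y) = c ^ 3 * f y := eval_smul_of_isHomogeneous h3
  have hg4 : ∀ (c : ℝ) y, g (c • y) = c ^ 4 * g y := eval_smul_of_isHomogeneous h4
  have he : (1, 0) ∈ H := by
    have := (eventually_levelCurve_mem hfc hgc hf3 hg4 0).self_of_nhds
    rwa [levelCurve_zero hf3 hg4, ← hH] at this
  intro yb hyb hcrit
  have heq (v y : Fin n → ℝ) (hy : ∑ i, y i * y i = 1) : ∃ η : Fin n → ℝ,
      fderiv ℝ f y v = 2 * ∑ i, y i * η i ∧ fderiv ℝ f y η + fderiv ℝ g y v = ∑ i, y i * v i ∧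
        f y * (∑ i, y i * v i) + 2 * fderiv ℝ g y η = 0 := by
    obtain ⟨L, hL, hLe⟩ := exists_infinitesimal_automorphism_quartic hfc hgc hf3 hg4
      (fun q hq => hhom _ he q (hH ▸ hq)) v
    exact exists_infinitesimal_equations hfd hgd hL hLe hy
  rcases critical_values_of_infinitesimal_equations hfd hgd hf3 hg4 heq hyb fun u hu => by
      have := hcrit u hu
      rw [fderiv_quartic_one hfd hgd ((contDiff_quartic hfc hgc).differentiable (by norm_num)),
        hu] at this
      linarith with h | ⟨ha, hb⟩
  · exact Or.inl h
  · refine Or.inr ⟨?_, hb⟩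
    refine (sq_eq_sq₀ (abs_nonneg _) (by positivity)).1 ?_
    rw [sq_abs, div_pow, mul_pow, mul_pow, Real.sq_sqrt (by norm_num), Real.sq_sqrt (by norm_num)]
    refine ha.trans ?_
    norm_num
end
end
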